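/- For all fixed integers t ≥ 2 and r ≥ 3 with gcd(⌊t²/4⌋ + t, r) = 1, there exist a constant c > 0 and an integer N such that for every n ≥ N there exists an r-graph H on vertex set [n] which is a t-parent-identifying set system and has at least c · n^{r/(⌊t²/4⌋+t)} · (log n)^{1/(⌊t²/4⌋+t)} edges. -/

import Mathlib

set_option linter.unusedSectionVars false
namespace IPPS
open Finset

section Prob
variable {ι : Type*} [Fintype ι] [DecidableEq ι]

/-- Bernoulli weight. -/
noncomputable def bw (p : ℝ) (b : Bool) : ℝ := if b then p else 1 - p

/-- Product weight. -/
noncomputable def wt (q : ι → ℝ) (ω : ι → Bool) : ℝ := ∏ i, bw (q i) (ω i)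

/-- Expectation on the finite product space. -/
noncomputable def Ex (q : ι → ℝ) (f : (ι → Bool) → ℝ) : ℝ := ∑ ω, wt q ω * f ω

lemma Ex_prod_univ (q : ι → ℝ) (g : ι → Bool → ℝ) :
    Ex q (fun ω => ∏ i, g i (ω i)) = ∏ i, (q i * g i true + (1 - q i) * g i false) := by
  have h := Finset.prod_univ_sum (fun _ : ι => (Finset.univ : Finset Bool))
    (fun i b => bw (q i) b * g i b)
  unfold Ex wt
  simp only [Fintype.piFinset_univ] at h
  simp only [← Finset.prod_mul_distrib]
  rw [← h]
  apply Finset.prod_congr rfl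
  intro i _
  simp [bw]

lemma sum_wt (q : ι → ℝ) : ∑ ω, wt q ω = 1 := by
  have h := Ex_prod_univ q (fun _ _ => 1)
  simpa [Ex] using h

lemma Ex_const (q : ι → ℝ) (c : ℝ) : Ex q (fun _ => c) = c := by
  unfold Ex
  rw [← Finset.sum_mul, sum_wt, one_mul]

lemma Ex_add (q : ι → ℝ) (f g : (ι → Bool) → ℝ) :
    Ex q (fun ω => f ω + g ω) = Ex q f + Ex q g := by
  unfold Ex
  rw [← Finset.sum_add_distrib]
  exact Finset.sum_congr rfl fun ω _ => by ring

lemma Ex_sub (q : ι → ℝ) (f g : (ι → Bool) → ℝ) :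
    Ex q (fun ω => f ω - g ω) = Ex q f - Ex q g := by
  unfold Ex
  rw [← Finset.sum_sub_distrib]
  exact Finset.sum_congr rfl fun ω _ => by ring

lemma Ex_const_mul (q : ι → ℝ) (c : ℝ) (f : (ι → Bool) → ℝ) :
    Ex q (fun ω => c * f ω) = c * Ex q f := by
  unfold Ex
  rw [Finset.mul_sum]
  exact Finset.sum_congr rfl fun ω _ => by ring

lemma Ex_sum {κ : Type*} (q : ι → ℝ) (s : Finset κ) (f : κ → (ι → Bool) → ℝ) :
    Ex q (fun ω => ∑ a ∈ s, f a ω) = ∑ a ∈ s, Ex q (f a) := by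
  unfold Ex
  rw [Finset.sum_comm]
  exact Finset.sum_congr rfl fun ω _ => by rw [Finset.mul_sum]

lemma wt_nonneg {q : ι → ℝ} (h0 : ∀ i, 0 ≤ q i) (h1 : ∀ i, q i ≤ 1) (ω : ι → Bool) :
    0 ≤ wt q ω := by
  unfold wt bw
  apply Finset.prod_nonneg
  intro i _
  split_ifs
  · exact h0 i
  · linarith [h1 i]

lemma Ex_mono {q : ι → ℝ} (h0 : ∀ i, 0 ≤ q i) (h1 : ∀ i, q i ≤ 1)
    {f g : (ι → Bool) → ℝ} (h : ∀ ω, f ω ≤ g ω) : Ex q f ≤ Ex q g := by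
  unfold Ex
  apply Finset.sum_le_sum
  intro ω _
  exact mul_le_mul_of_nonneg_left (h ω) (wt_nonneg h0 h1 ω)

lemma Ex_nonneg {q : ι → ℝ} (h0 : ∀ i, 0 ≤ q i) (h1 : ∀ i, q i ≤ 1)
    {f : (ι → Bool) → ℝ} (h : ∀ ω, 0 ≤ f ω) : 0 ≤ Ex q f := by
  have := Ex_mono h0 h1 (f := fun _ => 0) h
  rwa [Ex_const] at this

lemma exists_ge_Ex {q : ι → ℝ} (h0 : ∀ i, 0 ≤ q i) (h1 : ∀ i, q i ≤ 1)
    (f : (ι → Bool) → ℝ) : ∃ ω, Ex q f ≤ f ω := by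
  by_contra hcon
  push Not at hcon
  obtain ⟨ω0, -, h⟩ := Finset.exists_max_image (Finset.univ : Finset (ι → Bool)) f
    ⟨fun _ => true, Finset.mem_univ _⟩
  have h2 := Ex_mono h0 h1 (f := f) (g := fun _ => f ω0) (fun ω => h ω (Finset.mem_univ _))
  rw [Ex_const] at h2
  linarith [hcon ω0]

/-- swap the coordinates in `B`. -/
def swapE (B : Set ι) [DecidablePred (· ∈ B)] :
    ((ι → Bool) × (ι → Bool)) → ((ι → Bool) × (ι → Bool)) := fun x =>
  (fun i => if i ∈ B then x.2 i else x.1 i, fun i => if i ∈ B then x.1 i else x.2 i)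

lemma Ex_mul {q : ι → ℝ} {f g : (ι → Bool) → ℝ} {A B : Set ι}
    (hf : DependsOn f A) (hg : DependsOn g B) (hAB : Disjoint A B) :
    Ex q (fun ω => f ω * g ω) = Ex q f * Ex q g := by
  classical
  have hinv : Function.Involutive (swapE B) := by
    intro x
    ext i <;> simp only [swapE] <;> split_ifs <;> rfl
  have e1 : Ex q f * Ex q g =
      ∑ x : (ι → Bool) × (ι → Bool), (wt q x.1 * wt q x.2) * (f x.1 * g x.2) := by
    unfold Ex
    rw [Finset.sum_mul_sum, Fintype.sum_prod_type]
    exact Finset.sum_congr rfl fun ω _ => Finset.sum_congr rfl fun ω' _ => by ring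
  have e2 : Ex q (fun ω => f ω * g ω) =
      ∑ x : (ι → Bool) × (ι → Bool), (wt q x.1 * wt q x.2) * (f x.1 * g x.1) := by
    rw [Fintype.sum_prod_type]
    unfold Ex
    apply Finset.sum_congr rfl
    intro ω _
    have : ∀ y, (wt q ω * wt q y) * (f ω * g ω) = (wt q ω * (f ω * g ω)) * wt q y := by
      intro y; ring
    simp only [this]
    rw [← Finset.mul_sum, sum_wt, mul_one]
  rw [e1, e2, ← Equiv.sum_comp (hinv.toPerm (swapE B))]
  apply Finset.sum_congr rfl
  intro x _
  simp only [Function.Involutive.coe_toPerm]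
  have hw : wt q (swapE B x).1 * wt q (swapE B x).2 = wt q x.1 * wt q x.2 := by
    unfold wt
    rw [← Finset.prod_mul_distrib, ← Finset.prod_mul_distrib]
    apply Finset.prod_congr rfl
    intro i _
    simp only [swapE]
    split_ifs
    · ring
    · rfl
  have h1 : f (swapE B x).1 = f x.1 := by
    apply hf
    intro i hi
    have : i ∉ B := fun h => Set.disjoint_left.1 hAB hi h
    simp [swapE, this]
  have h2 : g (swapE B x).1 = g x.2 := by
    apply hg
    intro i hi
    simp [swapE, hi]
  rw [hw, h1, h2]

lemma DependsOn_mono {β : Type*} {f : (ι → Bool) → β} {A B : Set ι} (hf : DependsOn f A)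
    (h : A ⊆ B) : DependsOn f B := fun _ _ hxy => hf fun i hi => hxy i (h hi)

lemma DependsOn_prod {κ : Type*} (s : Finset κ) (f : κ → (ι → Bool) → ℝ) (A : κ → Set ι)
    (hf : ∀ a ∈ s, DependsOn (f a) (A a)) :
    DependsOn (fun ω => ∏ a ∈ s, f a ω) (⋃ a ∈ s, A a) := by
  intro x y hxy
  apply Finset.prod_congr rfl
  intro a ha
  apply hf a ha
  intro i hi
  exact hxy i (Set.mem_biUnion (show a ∈ (s : Set κ) from ha) hi)

lemma Ex_prod {κ : Type*} [DecidableEq κ] {q : ι → ℝ} (s : Finset κ)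
    (f : κ → (ι → Bool) → ℝ) (A : κ → Set ι)
    (hf : ∀ a ∈ s, DependsOn (f a) (A a))
    (hd : ∀ a ∈ s, ∀ b ∈ s, a ≠ b → Disjoint (A a) (A b)) :
    Ex q (fun ω => ∏ a ∈ s, f a ω) = ∏ a ∈ s, Ex q (f a) := by
  induction s using Finset.induction_on with
  | empty => simp [Ex_const]
  | insert a s ha ih =>
    simp only [Finset.prod_insert ha]
    rw [Ex_mul (hf a (Finset.mem_insert_self _ _))
      (DependsOn_prod s f A fun b hb => hf b (Finset.mem_insert_of_mem hb)), ih]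
    · exact fun b hb => hf b (Finset.mem_insert_of_mem hb)
    · exact fun b hb c hc => hd b (Finset.mem_insert_of_mem hb) c (Finset.mem_insert_of_mem hc)
    · rw [Set.disjoint_iUnion₂_right]
      intro b hb
      exact hd a (Finset.mem_insert_self _ _) b (Finset.mem_insert_of_mem hb)
        (fun h => ha (h ▸ hb))

open Classical in
/-- indicator -/
noncomputable def ind (P : Prop) : ℝ := if P then 1 else 0

lemma ind_nonneg (P : Prop) : 0 ≤ ind P := by unfold ind; split_ifs <;> norm_num
lemma ind_le_one (P : Prop) : ind P ≤ 1 := by unfold ind; split_ifs <;> norm_num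
lemma ind_true {P : Prop} (h : P) : ind P = 1 := by simp [ind, h]
lemma ind_false {P : Prop} (h : ¬ P) : ind P = 0 := by simp [ind, h]
lemma ind_sq (P : Prop) : ind P * ind P = ind P := by unfold ind; split_ifs <;> norm_num

lemma Ex_ind_all (q : ι → ℝ) (s : Finset ι) :
    Ex q (fun ω => ind (∀ i ∈ s, ω i = true)) = ∏ i ∈ s, q i := by
  have h := Ex_prod_univ q (fun i b => if i ∈ s then (if b then 1 else 0) else 1)
  have e1 : (fun ω : ι → Bool => ind (∀ i ∈ s, ω i = true)) =
      fun ω => ∏ i, (if i ∈ s then (if ω i then (1:ℝ) else 0) else 1) := by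
    funext ω
    by_cases hω : ∀ i ∈ s, ω i = true
    · rw [ind_true hω, Finset.prod_eq_one]
      intro i _
      split_ifs with h1 h2
      · rfl
      · exact absurd (hω i h1) h2
      · rfl
    · rw [ind_false hω]
      push Not at hω
      obtain ⟨i, hi, hi2⟩ := hω
      symm
      apply Finset.prod_eq_zero (Finset.mem_univ i)
      simp [hi, hi2]
  rw [e1, h, ← Finset.prod_subset (Finset.subset_univ s)]
  · apply Finset.prod_congr rfl
    intro i hi
    simp [hi]
  · intro i _ hi
    simp [hi]

lemma Ex_ind_true (q : ι → ℝ) (i : ι) : Ex q (fun ω => ind (ω i = true)) = q i := by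
  have := Ex_ind_all q {i}
  simpa using this

lemma Ex_ind_false (q : ι → ℝ) (i : ι) : Ex q (fun ω => ind (ω i = false)) = 1 - q i := by
  have : (fun ω : ι → Bool => ind (ω i = false)) = fun ω => 1 - ind (ω i = true) := by
    funext ω
    cases h : ω i <;> simp [ind]
  rw [this, Ex_sub, Ex_const, Ex_ind_true]

lemma chebyshev {κ : Type*} [DecidableEq κ] {q : ι → ℝ} (h0 : ∀ i, 0 ≤ q i) (h1 : ∀ i, q i ≤ 1)
    (s : Finset κ) (P : κ → (ι → Bool) → Prop)
    (hind : ∀ a ∈ s, ∀ b ∈ s, a ≠ b → Ex q (fun ω => ind (P a ω) * ind (P b ω)) =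
      Ex q (fun ω => ind (P a ω)) * Ex q (fun ω => ind (P b ω)))
    (μ τ : ℝ) (hμ : ∑ a ∈ s, Ex q (fun ω => ind (P a ω)) ≤ μ) (hτ : 0 < τ) :
    Ex q (fun ω => ind (μ + τ < ∑ a ∈ s, ind (P a ω))) ≤ μ / τ ^ 2 := by
  set m := ∑ a ∈ s, Ex q (fun ω => ind (P a ω)) with hm
  set X : (ι → Bool) → ℝ := fun ω => ∑ a ∈ s, ind (P a ω) with hX
  have hEX : Ex q X = m := by rw [hX, Ex_sum]
  have hEXX : Ex q (fun ω => X ω * X ω) ≤ m + m * m := by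
    have : (fun ω => X ω * X ω) = fun ω => ∑ a ∈ s, ∑ b ∈ s, ind (P a ω) * ind (P b ω) := by
      funext ω
      simp only [hX]
      rw [Finset.sum_mul_sum]
    rw [this, Ex_sum]
    simp only [Ex_sum]
    have hle : ∀ a ∈ s, ∑ b ∈ s, Ex q (fun ω => ind (P a ω) * ind (P b ω)) ≤
        Ex q (fun ω => ind (P a ω)) + Ex q (fun ω => ind (P a ω)) * m := by
      intro a ha
      rw [← Finset.add_sum_erase s _ ha, hm, Finset.mul_sum, ← Finset.add_sum_erase s (fun b =>
        Ex q (fun ω => ind (P a ω)) * Ex q (fun ω => ind (P b ω))) ha]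
      have e1 : Ex q (fun ω => ind (P a ω) * ind (P a ω)) = Ex q (fun ω => ind (P a ω)) := by
        simp only [ind_sq]
      have e2 : ∑ b ∈ s.erase a, Ex q (fun ω => ind (P a ω) * ind (P b ω)) =
          ∑ b ∈ s.erase a, Ex q (fun ω => ind (P a ω)) * Ex q (fun ω => ind (P b ω)) := by
        apply Finset.sum_congr rfl
        intro b hb
        exact hind a ha b (Finset.mem_of_mem_erase hb) (Finset.ne_of_mem_erase hb).symm
      rw [e1, e2]
      have := mul_self_nonneg (Ex q (fun ω => ind (P a ω)))
      linarith
    calc _ ≤ ∑ a ∈ s, (Ex q (fun ω => ind (P a ω)) + Ex q (fun ω => ind (P a ω)) * m) :=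
          Finset.sum_le_sum hle
      _ = m + m * m := by rw [Finset.sum_add_distrib, ← Finset.sum_mul]
  have key : Ex q (fun ω => τ ^ 2 * ind (μ + τ < X ω)) ≤
      Ex q (fun ω => (X ω * X ω - (2 * m) * X ω) + m * m) := by
    apply Ex_mono h0 h1
    intro ω
    by_cases h : μ + τ < X ω
    · rw [ind_true h]
      nlinarith
    · rw [ind_false h]
      nlinarith [sq_nonneg (X ω - m)]
  rw [Ex_const_mul, Ex_add, Ex_sub, Ex_const_mul, Ex_const, hEX] at key
  rw [le_div_iff₀ (by positivity)]
  nlinarith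

end Prob
end IPPS

set_option linter.unusedSectionVars false
namespace IPPS
open Finset

section Hyper
variable {V : Type*} [Fintype V] [DecidableEq V]

/-- no Berge cycles of length 2, 3, 4 -/
structure Acyc (H : Finset (Finset V)) : Prop where
  c2 : ∀ e ∈ H, ∀ f ∈ H, e ≠ f → ∀ x y, x ∈ e → x ∈ f → y ∈ e → y ∈ f → x = y
  c3 : ∀ e ∈ H, ∀ f ∈ H, ∀ g ∈ H, e ≠ f → f ≠ g → e ≠ g →
    ∀ x y z, x ≠ y → y ≠ z → x ≠ z → x ∈ e → x ∈ f → y ∈ f → y ∈ g → z ∈ g → z ∈ e → False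
  c4 : ∀ e ∈ H, ∀ f ∈ H, ∀ g ∈ H, ∀ h ∈ H, e ≠ f → e ≠ g → e ≠ h → f ≠ g → f ≠ h → g ≠ h →
    ∀ x y z w, x ≠ y → x ≠ z → x ≠ w → y ≠ z → y ≠ w → z ≠ w →
    x ∈ e → x ∈ f → y ∈ f → y ∈ g → z ∈ g → z ∈ h → w ∈ h → w ∈ e → False

/-- class of hypergraphs in the nibble. -/
structure Cls (k : ℕ) (U : Finset V) (H : Finset (Finset V)) (K b : ℝ) : Prop where
  acyc : Acyc H
  sub : ∀ e ∈ H, e ⊆ U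
  two : ∀ e ∈ H, 2 ≤ e.card
  le : ∀ e ∈ H, e.card ≤ k + 1
  deg : ∀ v ∈ U, ∀ a, 1 ≤ a → a ≤ k →
    ((H.filter (fun e => v ∈ e ∧ e.card = a + 1)).card : ℝ) ≤ k.choose a * K ^ (k - a) * b ^ a

/-- independent set -/
def Ind (H : Finset (Finset V)) (I : Finset V) : Prop := ∀ e ∈ H, ¬ e ⊆ I

lemma Acyc.shrink {H H' : Finset (Finset V)} (h : Acyc H) (g : Finset V → Finset V)
    (hg : ∀ e ∈ H', g e ∈ H) (hs : ∀ e ∈ H', e ⊆ g e)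
    (hi : ∀ e ∈ H', ∀ f ∈ H', e ≠ f → g e ≠ g f) : Acyc H' := by
  refine ⟨?_, ?_, ?_⟩
  · intro e he f hf hef x y h1 h2 h3 h4
    exact h.c2 (g e) (hg e he) (g f) (hg f hf) (hi e he f hf hef) x y (hs e he h1) (hs f hf h2)
      (hs e he h3) (hs f hf h4)
  · intro e he f hf k hk hef hfk hek x y z hxy hyz hxz h1 h2 h3 h4 h5 h6
    exact h.c3 _ (hg e he) _ (hg f hf) _ (hg k hk) (hi e he f hf hef) (hi f hf k hk hfk)
      (hi e he k hk hek) x y z hxy hyz hxz (hs e he h1) (hs f hf h2) (hs f hf h3) (hs k hk h4)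
      (hs k hk h5) (hs e he h6)
  · intro e he f hf k hk l hl n1 n2 n3 n4 n5 n6 x y z w m1 m2 m3 m4 m5 m6 h1 h2 h3 h4 h5 h6 h7 h8
    exact h.c4 _ (hg e he) _ (hg f hf) _ (hg k hk) _ (hg l hl) (hi e he f hf n1)
      (hi e he k hk n2) (hi e he l hl n3) (hi f hf k hk n4) (hi f hf l hl n5) (hi k hk l hl n6)
      x y z w m1 m2 m3 m4 m5 m6 (hs e he h1) (hs f hf h2) (hs f hf h3) (hs k hk h4)
      (hs k hk h5) (hs l hl h6) (hs l hl h7) (hs e he h8)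

lemma Cls.deg_sum {k : ℕ} {U : Finset V} {H : Finset (Finset V)} {K b : ℝ}
    (h : Cls k U H K b) {v : V} (hv : v ∈ U) (g : ℕ → ℝ) (hg : ∀ a, 0 ≤ g a) :
    ∑ e ∈ H.filter (fun e => v ∈ e), g (e.card - 1) ≤
      ∑ a ∈ Finset.Icc 1 k, k.choose a * K ^ (k - a) * b ^ a * g a := by
  have hm : ∀ e ∈ H.filter (fun e => v ∈ e), e.card - 1 ∈ Finset.Icc 1 k := by
    intro e he
    have he := (Finset.mem_filter.1 he).1
    have := h.two e he
    have := h.le e he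
    rw [Finset.mem_Icc]; omega
  rw [← Finset.sum_fiberwise_of_maps_to hm]
  apply Finset.sum_le_sum
  intro a ha
  rw [Finset.mem_Icc] at ha
  have e1 : (H.filter (fun e => v ∈ e)).filter (fun e => e.card - 1 = a) =
      H.filter (fun e => v ∈ e ∧ e.card = a + 1) := by
    ext e
    simp only [Finset.mem_filter]
    constructor
    · rintro ⟨⟨h1, h2⟩, h3⟩
      have := h.two e h1
      exact ⟨h1, h2, by omega⟩
    · rintro ⟨h1, h2, h3⟩
      exact ⟨⟨h1, h2⟩, by omega⟩
  rw [Finset.sum_congr e1 (g := fun _ => g a)]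
  · rw [Finset.sum_const, nsmul_eq_mul]
    exact mul_le_mul_of_nonneg_right (h.deg v hv a ha.1 ha.2) (hg a)
  · intro e he
    have := (Finset.mem_filter.1 he).2.2
    rw [this, Nat.add_sub_cancel]

/-- no edge of `F` is completed at `w` -/
def nb (F : Finset (Finset V)) (w : V) (ω : V ⊕ V → Bool) : Prop :=
  ∀ f ∈ F, ¬ ∀ x ∈ f.erase w, ω (Sum.inl x) = true

/-- coordinates used by `nb` -/
def nbS (F : Finset (Finset V)) (w : V) : Set (V ⊕ V) :=
  {i | ∃ f ∈ F, ∃ x ∈ f.erase w, i = Sum.inl x}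

lemma nb_congr {F : Finset (Finset V)} {w : V} {ω ω' : V ⊕ V → Bool}
    (h : ∀ i ∈ nbS F w, ω i = ω' i) : nb F w ω ↔ nb F w ω' := by
  unfold nb
  apply forall₂_congr
  intro f hf
  apply not_congr
  apply forall₂_congr
  intro x hx
  rw [h (Sum.inl x) ⟨f, hf, x, hx, rfl⟩]

lemma Ex_nb (q : V ⊕ V → ℝ) (p : ℝ) (hq : ∀ v, q (Sum.inl v) = p) (F : Finset (Finset V)) (w : V)
    (hw : ∀ f ∈ F, w ∈ f)
    (hF : ∀ e ∈ F, ∀ f ∈ F, e ≠ f → ∀ x y, x ∈ e → x ∈ f → y ∈ e → y ∈ f → x = y) :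
    Ex q (fun ω => ind (nb F w ω)) = ∏ f ∈ F, (1 - p ^ (f.card - 1)) := by
  have e1 : (fun ω => ind (nb F w ω)) = fun ω : V ⊕ V → Bool =>
      ∏ f ∈ F, (1 - ind (∀ x ∈ f.erase w, ω (Sum.inl x) = true)) := by
    funext ω
    by_cases h : nb F w ω
    · rw [ind_true h, Finset.prod_eq_one]
      intro f hf
      rw [ind_false (h f hf), sub_zero]
    · rw [ind_false h]
      unfold nb at h
      push Not at h
      obtain ⟨f, hf, h⟩ := h
      symm
      apply Finset.prod_eq_zero hf
      rw [ind_true h, sub_self]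
  rw [e1, Ex_prod F _ (fun f => nbS {f} w)]
  · apply Finset.prod_congr rfl
    intro f hf
    rw [Ex_sub, Ex_const]
    have := Ex_ind_all q ((f.erase w).map ⟨Sum.inl, Sum.inl_injective⟩)
    simp only [Finset.mem_map, Function.Embedding.coeFn_mk, forall_exists_index, and_imp,
      forall_apply_eq_imp_iff₂, Finset.prod_map, hq, Finset.prod_const,
      Finset.card_erase_of_mem (hw f hf)] at this
    rw [this]
  · intro f hf x y hxy
    have : (∀ z ∈ f.erase w, x (Sum.inl z) = true) ↔ (∀ z ∈ f.erase w, y (Sum.inl z) = true) := by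
      apply forall₂_congr
      intro z hz
      rw [hxy (Sum.inl z) ⟨f, Finset.mem_singleton_self _, z, hz, rfl⟩]
    simp only [this]
  · intro e he f hf hef
    rw [Set.disjoint_left]
    rintro i ⟨e', he', x, hx, rfl⟩ ⟨f', hf', y, hy, hxy⟩
    rw [Finset.mem_singleton] at he' hf'
    subst he' hf'
    have hxy : x = y := Sum.inl_injective hxy
    subst hxy
    rw [Finset.mem_erase] at hx hy
    exact hx.1 (hF _ he _ hf hef x w hx.2 hy.2 (hw _ he) (hw _ hf))

/-- survive, ignoring edges through `v` -/
def surv (H : Finset (Finset V)) (v w : V) (ω : V ⊕ V → Bool) : Prop :=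
  ω (Sum.inl w) = false ∧ ω (Sum.inr w) = true ∧
    nb (H.filter (fun f => w ∈ f ∧ v ∉ f)) w ω

/-- coordinates used by `surv` -/
def survS (H : Finset (Finset V)) (v w : V) : Set (V ⊕ V) :=
  {Sum.inl w} ∪ ({Sum.inr w} ∪ nbS (H.filter (fun f => w ∈ f ∧ v ∉ f)) w)

lemma surv_congr {H : Finset (Finset V)} {v w : V} {ω ω' : V ⊕ V → Bool}
    (h : ∀ i ∈ survS H v w, ω i = ω' i) : surv H v w ω ↔ surv H v w ω' := by
  unfold surv
  rw [h (Sum.inl w) (by simp [survS]), h (Sum.inr w) (by simp [survS]),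
    nb_congr (fun i hi => h i (Or.inr (Or.inr hi)))]

lemma ind_and (P Q : Prop) : ind (P ∧ Q) = ind P * ind Q := by
  by_cases hP : P <;> by_cases hQ : Q <;> simp [ind, hP, hQ]

lemma Ex_three (q : V ⊕ V → ℝ) (F : Finset (Finset V)) (w : V) (bb : Bool) :
    Ex q (fun ω => ind (ω (Sum.inl w) = bb ∧ ω (Sum.inr w) = true ∧ nb F w ω)) =
      Ex q (fun ω => ind (ω (Sum.inl w) = bb)) * (q (Sum.inr w) * Ex q (fun ω => ind (nb F w ω)))
      := by
  simp only [ind_and]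
  have d1 : DependsOn (fun ω : V ⊕ V → Bool => ind (ω (Sum.inl w) = bb)) {Sum.inl w} := by
    intro x y hxy; simp only [hxy (Sum.inl w) rfl]
  have d2 : DependsOn (fun ω : V ⊕ V → Bool => ind (ω (Sum.inr w) = true)) {Sum.inr w} := by
    intro x y hxy; simp only [hxy (Sum.inr w) rfl]
  have d3 : DependsOn (fun ω : V ⊕ V → Bool => ind (nb F w ω)) (nbS F w) := by
    intro x y hxy; simp only [nb_congr hxy]
  have d23 : DependsOn (fun ω : V ⊕ V → Bool => ind (ω (Sum.inr w) = true) * ind (nb F w ω))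
      ({Sum.inr w} ∪ nbS F w) := by
    intro x y hxy
    have h1 := d2 (x := x) (y := y) (fun i hi => hxy i (Or.inl hi))
    have h2 := d3 (x := x) (y := y) (fun i hi => hxy i (Or.inr hi))
    simp only at h1 h2
    simp only [h1, h2]
  rw [Ex_mul d1 d23, Ex_mul d2 d3, Ex_ind_true]
  · rw [Set.disjoint_left]
    rintro i hi ⟨f, hf, x, hx, h⟩
    rw [Set.mem_singleton_iff] at hi
    subst hi
    simp at h
  · rw [Set.disjoint_left]
    rintro i hi h
    rw [Set.mem_singleton_iff] at hi
    subst hi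
    rcases h with h | ⟨f, hf, x, hx, h⟩
    · simp at h
    · have : w = x := Sum.inl_injective h
      subst this
      simp at hx

lemma Ex_pair (q : V ⊕ V → ℝ) (F : Finset (Finset V)) (w : V) (bb : Bool) :
    Ex q (fun ω => ind (ω (Sum.inl w) = bb ∧ nb F w ω)) =
      Ex q (fun ω => ind (ω (Sum.inl w) = bb)) * Ex q (fun ω => ind (nb F w ω))
      := by
  simp only [ind_and]
  have d1 : DependsOn (fun ω : V ⊕ V → Bool => ind (ω (Sum.inl w) = bb)) {Sum.inl w} := by
    intro x y hxy; simp only [hxy (Sum.inl w) rfl]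
  have d3 : DependsOn (fun ω : V ⊕ V → Bool => ind (nb F w ω)) (nbS F w) := by
    intro x y hxy; simp only [nb_congr hxy]
  rw [Ex_mul d1 d3]
  · rw [Set.disjoint_left]
    rintro i hi ⟨f, hf, x, hx, h⟩
    rw [Set.mem_singleton_iff] at hi
    subst hi
    have : w = x := Sum.inl_injective h
    subst this
    simp at hx

lemma survS_disj {H : Finset (Finset V)} (hA : Acyc H) {v w w' : V} {e e' : Finset V}
    (he : e ∈ H) (he' : e' ∈ H) (hv : v ∈ e) (hvp : v ∈ e') (hw : w ∈ e.erase v)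
    (hw' : w' ∈ e'.erase v) (hne : w ≠ w') : Disjoint (survS H v w) (survS H v w') := by
  rw [Finset.mem_erase] at hw hw'
  have two : ∀ f ∈ H, v ∉ f → w ∈ f → w' ∈ f → False := by
    intro f hf hvf h1 h2
    by_cases hee : e = e'
    · subst hee
      exact hne (hA.c2 e he f hf (fun h => hvf (h ▸ hv)) w w' hw.2 h1 hw'.2 h2)
    · exact hA.c3 e he f hf e' he' (fun h => hvf (h ▸ hv)) (fun h => hvf (h ▸ hvp)) hee w w' v
        hne hw'.1 hw.1 hw.2 h1 h2 hw'.2 hvp hv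
  rw [Set.disjoint_left]
  intro i hi hi'
  rcases hi with rfl | rfl | ⟨f, hf, x, hx, rfl⟩
  · rcases hi' with h | h | ⟨f', hf', x', hx', h⟩
    · exact hne (Sum.inl_injective h)
    · simp at h
    · have := Sum.inl_injective h
      subst this
      simp only [Finset.mem_filter, Finset.mem_erase] at hf' hx'
      exact two f' hf'.1 hf'.2.2 hx'.2 hf'.2.1
  · rcases hi' with h | h | ⟨f', hf', x', hx', h⟩
    · simp at h
    · exact hne (Sum.inr_injective h)
    · simp at h
  · simp only [Finset.mem_filter, Finset.mem_erase] at hf hx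
    rcases hi' with h | h | ⟨f', hf', x', hx', h⟩
    · have := Sum.inl_injective h
      subst this
      exact two f hf.1 hf.2.2 hf.2.1 hx.2
    · simp at h
    · have := Sum.inl_injective h
      subst this
      simp only [Finset.mem_filter, Finset.mem_erase] at hf' hx'
      have hxv : x ≠ v := fun h => hf.2.2 (h ▸ hx.2)
      by_cases hff : f = f'
      · subst hff
        exact two f hf.1 hf.2.2 hf.2.1 hf'.2.1
      by_cases hee : e = e'
      · subst hee
        exact hA.c3 e he f hf.1 f' hf'.1 (fun h => hf.2.2 (h ▸ hv)) hff
          (fun h => hf'.2.2 (h ▸ hv)) w x w' hx.1.symm hx'.1 hne hw.2 hf.2.1 hx.2 hx'.2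
          hf'.2.1 hw'.2
      · exact hA.c4 e he f hf.1 f' hf'.1 e' he' (fun h => hf.2.2 (h ▸ hv))
          (fun h => hf'.2.2 (h ▸ hv)) hee hff (fun h => hf.2.2 (h ▸ hvp))
          (fun h => hf'.2.2 (h ▸ hvp)) w x w' v hx.1.symm hne hw.1 hx'.1 hxv hw'.1
          hw.2 hf.2.1 hx.2 hx'.2 hf'.2.1 hw'.2 hvp hv

/-- edge event -/
def Aev (H : Finset (Finset V)) (v : V) (a : ℕ) (e : Finset V) (ω : V ⊕ V → Bool) : Prop :=
  (∀ w ∈ e.erase v, ω (Sum.inl w) = true ∨ surv H v w ω) ∧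
    ((e.erase v).filter (fun w => ω (Sum.inl w) = false)).card = a

/-- coordinates used by `Aev` -/
def AevS (H : Finset (Finset V)) (v : V) (e : Finset V) : Set (V ⊕ V) :=
  {i | ∃ w ∈ e.erase v, i ∈ survS H v w}

lemma Aev_dep (H : Finset (Finset V)) (v : V) (a : ℕ) (e : Finset V) :
    DependsOn (fun ω => ind (Aev H v a e ω)) (AevS H v e) := by
  intro x y hxy
  have h1 : ∀ w ∈ e.erase v, x (Sum.inl w) = y (Sum.inl w) := fun w hw =>
    hxy (Sum.inl w) ⟨w, hw, Or.inl rfl⟩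
  have h2 : ∀ w ∈ e.erase v, (surv H v w x ↔ surv H v w y) := fun w hw =>
    surv_congr fun i hi => hxy i ⟨w, hw, hi⟩
  have : Aev H v a e x ↔ Aev H v a e y := by
    unfold Aev
    apply and_congr
    · apply forall₂_congr
      intro w hw
      rw [h1 w hw, h2 w hw]
    · rw [Finset.filter_congr (fun w hw => by rw [h1 w hw])]
  simp only [this]

lemma AevS_disj {H : Finset (Finset V)} (hA : Acyc H) {v : V} {e e' : Finset V}
    (he : e ∈ H) (he' : e' ∈ H) (hv : v ∈ e) (hvp : v ∈ e') (hne : e ≠ e') :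
    Disjoint (AevS H v e) (AevS H v e') := by
  rw [Set.disjoint_left]
  rintro i ⟨w, hw, hi⟩ ⟨w', hw', hi'⟩
  refine Set.disjoint_left.1 (survS_disj hA he he' hv hvp hw hw' ?_) hi hi'
  rintro rfl
  rw [Finset.mem_erase] at hw hw'
  exact hw.1 (hA.c2 e he e' he' hne w v hw.2 hw'.2 hv hvp)

/-- unblocked probability -/
noncomputable def Pu (H : Finset (Finset V)) (p : ℝ) (w : V) : ℝ :=
  ∏ f ∈ H.filter (fun f => w ∈ f), (1 - p ^ (f.card - 1))

/-- the coordinate probabilities -/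
noncomputable def qf (H : Finset (Finset V)) (p : ℝ) : V ⊕ V → ℝ :=
  Sum.elim (fun _ => p) (fun w => (1 / 2) / Pu H p w)

lemma Ex_unb {H : Finset (Finset V)} (hA : Acyc H) (p : ℝ) (w : V) :
    Ex (qf H p) (fun ω => ind (nb (H.filter (fun f => w ∈ f)) w ω)) = Pu H p w := by
  apply Ex_nb _ p (fun v => rfl)
  · intro f hf
    exact (Finset.mem_filter.1 hf).2
  · intro e he f hf
    exact hA.c2 e (Finset.mem_filter.1 he).1 f (Finset.mem_filter.1 hf).1

lemma Ex_surv_le {H : Finset (Finset V)} (hA : Acyc H) {p : ℝ} (hp0 : 0 ≤ p) (hp1 : p < 1)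
    {v w : V} {e : Finset V} (he : e ∈ H) (hv : v ∈ e) (hw : w ∈ e.erase v)
    (h2 : 2 ≤ e.card) (hP : 0 < Pu H p w) :
    Ex (qf H p) (fun ω => ind (surv H v w ω)) ≤ 1 / 2 := by
  rw [Finset.mem_erase] at hw
  unfold surv
  rw [Ex_three, Ex_ind_false, Ex_nb _ p (fun v => rfl)]
  rotate_left
  · intro f hf
    exact (Finset.mem_filter.1 hf).2.1
  · intro e he f hf
    exact hA.c2 e (Finset.mem_filter.1 he).1 f (Finset.mem_filter.1 hf).1
  have hins : H.filter (fun f => w ∈ f) = insert e (H.filter (fun f => w ∈ f ∧ v ∉ f)) := by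
    ext f
    simp only [Finset.mem_filter, Finset.mem_insert]
    constructor
    · rintro ⟨h1, h2⟩
      by_cases hvf : v ∈ f
      · left
        by_contra hne
        exact hw.1 (hA.c2 f h1 e he hne w v h2 hw.2 hvf hv)
      · exact Or.inr ⟨h1, h2, hvf⟩
    · rintro (rfl | ⟨h1, h2, h3⟩)
      · exact ⟨he, hw.2⟩
      · exact ⟨h1, h2⟩
  have hPu : Pu H p w = (1 - p ^ (e.card - 1)) *
      ∏ f ∈ H.filter (fun f => w ∈ f ∧ v ∉ f), (1 - p ^ (f.card - 1)) := by
    unfold Pu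
    rw [hins, Finset.prod_insert]
    simp [hv]
  set R := ∏ f ∈ H.filter (fun f => w ∈ f ∧ v ∉ f), (1 - p ^ (f.card - 1)) with hR
  have hpe : p ^ (e.card - 1) ≤ p := by
    calc p ^ (e.card - 1) ≤ p ^ 1 := pow_le_pow_of_le_one hp0 hp1.le (by omega)
      _ = p := pow_one p
  have hRpos : 0 < R := by
    rw [hPu] at hP
    exact (pos_iff_pos_of_mul_pos hP).1 (by linarith)
  have hq1 : qf H p (Sum.inl w) = p := rfl
  have hq2 : qf H p (Sum.inr w) = (1 / 2) / Pu H p w := rfl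
  rw [hq1, hq2]
  have e1 : (1 / 2) / Pu H p w * R = (1 / 2) / (1 - p ^ (e.card - 1)) := by
    rw [hPu]
    have : (1 - p ^ (e.card - 1)) ≠ 0 := by linarith
    field_simp
  rw [e1, ← mul_div_assoc, div_le_iff₀ (by linarith)]
  nlinarith

lemma Ex_Aev_le {H : Finset (Finset V)} (hA : Acyc H) {p : ℝ} (hp0 : 0 ≤ p) (hp1 : p < 1)
    {v : V} {e : Finset V} (he : e ∈ H) (hv : v ∈ e)
    (h2 : 2 ≤ e.card) (hP : ∀ w ∈ e, 1 / 2 ≤ Pu H p w) (a : ℕ)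
    (hq0 : ∀ i, 0 ≤ qf H p i) (hq1 : ∀ i, qf H p i ≤ 1) :
    Ex (qf H p) (fun ω => ind (Aev H v a e ω)) ≤
      (e.card - 1).choose a * p ^ (e.card - 1 - a) * (1 / 2) ^ a := by
  have hb : ∀ ω, ind (Aev H v a e ω) ≤ ∑ T ∈ Finset.powersetCard a (e.erase v),
      ∏ w ∈ e.erase v, (if w ∈ T then ind (surv H v w ω) else ind (ω (Sum.inl w) = true)) := by
    intro ω
    have hnn : ∀ T ∈ Finset.powersetCard a (e.erase v), 0 ≤ ∏ w ∈ e.erase v,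
        (if w ∈ T then ind (surv H v w ω) else ind (ω (Sum.inl w) = true)) := by
      intro T _
      apply Finset.prod_nonneg
      intro w _
      split_ifs <;> exact ind_nonneg _
    by_cases h : Aev H v a e ω
    · rw [ind_true h]
      have hT : (e.erase v).filter (fun w => ω (Sum.inl w) = false) ∈
          Finset.powersetCard a (e.erase v) := by
        rw [Finset.mem_powersetCard]
        exact ⟨Finset.filter_subset _ _, h.2⟩
      refine le_trans (le_of_eq ?_) (Finset.single_le_sum hnn hT)
      symm
      apply Finset.prod_eq_one
      intro w hw
      have := h.1 w hw
      split_ifs with hwT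
      · rw [Finset.mem_filter] at hwT
        rcases this with h | h
        · rw [hwT.2] at h; simp at h
        · exact ind_true h
      · rcases this with h | h
        · exact ind_true h
        · exact absurd (Finset.mem_filter.2 ⟨hw, h.1⟩) hwT
    · rw [ind_false h]
      exact Finset.sum_nonneg hnn
  refine (Ex_mono hq0 hq1 hb).trans ?_
  rw [Ex_sum]
  have hT : ∀ T ∈ Finset.powersetCard a (e.erase v), Ex (qf H p) (fun ω => ∏ w ∈ e.erase v,
      (if w ∈ T then ind (surv H v w ω) else ind (ω (Sum.inl w) = true))) ≤
        p ^ (e.card - 1 - a) * (1 / 2) ^ a := by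
    intro T hT
    rw [Finset.mem_powersetCard] at hT
    rw [Ex_prod (e.erase v) _ (fun w => survS H v w)]
    · have hle : ∀ w ∈ e.erase v, Ex (qf H p) (fun ω => (if w ∈ T then ind (surv H v w ω)
          else ind (ω (Sum.inl w) = true))) ≤ if w ∈ T then 1 / 2 else p := by
        intro w hw
        split_ifs
        · exact Ex_surv_le hA hp0 hp1 he hv hw h2
            (by linarith [hP w (Finset.mem_of_mem_erase hw)])
        · rw [Ex_ind_true]; exact le_refl _
      refine (Finset.prod_le_prod ?_ hle).trans ?_
      · intro w _
        apply Ex_nonneg hq0 hq1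
        intro ω
        split_ifs <;> exact ind_nonneg _
      · rw [Finset.prod_ite, Finset.prod_const, Finset.prod_const]
        have c1 : ((e.erase v).filter (fun w => w ∈ T)).card = a := by
          rw [Finset.filter_mem_eq_inter, Finset.inter_eq_right.2 hT.1, hT.2]
        have c2 : ((e.erase v).filter (fun w => w ∉ T)).card = e.card - 1 - a := by
          have := Finset.card_filter_add_card_filter_not (s := e.erase v) (fun w => w ∈ T)
          rw [c1, Finset.card_erase_of_mem hv] at this
          omega
        rw [c1, c2, mul_comm]
    · intro w hw x y hxy
      have h1 : surv H v w x ↔ surv H v w y := surv_congr hxy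
      have h2 : x (Sum.inl w) = y (Sum.inl w) := hxy _ (Or.inl rfl)
      simp only [h1, h2]
    · intro w hw w' hw' hne
      exact survS_disj hA he he hv hv hw hw' hne
  refine (Finset.sum_le_sum hT).trans (le_of_eq ?_)
  rw [Finset.sum_const, Finset.card_powersetCard, Finset.card_erase_of_mem hv, nsmul_eq_mul,
    mul_assoc]

end Hyper
end IPPS

set_option linter.unusedSectionVars false
namespace IPPS
open Finset

section Step
variable {V : Type*} [Fintype V] [DecidableEq V]

lemma binom_id (k a : ℕ) (ha : a ≤ k) (ha1 : 1 ≤ a) (K θ b : ℝ) (hb : 0 < b) :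
    ∑ c ∈ Finset.Icc 1 k, (k.choose c : ℝ) * K ^ (k - c) * b ^ c *
      ((c.choose a : ℝ) * (θ / b) ^ (c - a) * (1 / 2) ^ a) =
      k.choose a * (K + θ) ^ (k - a) * (b / 2) ^ a := by
  have e1 : ∑ c ∈ Finset.Icc 1 k, (k.choose c : ℝ) * K ^ (k - c) * b ^ c *
      ((c.choose a : ℝ) * (θ / b) ^ (c - a) * (1 / 2) ^ a) =
      ∑ c ∈ Finset.Icc a k, (k.choose c : ℝ) * K ^ (k - c) * b ^ c *
      ((c.choose a : ℝ) * (θ / b) ^ (c - a) * (1 / 2) ^ a) := by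
    symm
    apply Finset.sum_subset
    · intro c hc
      rw [Finset.mem_Icc] at hc ⊢; omega
    · intro c hc hc'
      rw [Finset.mem_Icc] at hc hc'
      rw [Nat.choose_eq_zero_of_lt (by omega : c < a)]
      simp
  rw [e1, ← Finset.Ico_add_one_right_eq_Icc, Finset.sum_Ico_eq_sum_range, add_comm K θ, add_pow,
    Finset.mul_sum, Finset.sum_mul, show k + 1 - a = k - a + 1 by omega]
  apply Finset.sum_congr rfl
  intro i hi
  rw [Finset.mem_range] at hi
  have h := Nat.choose_mul (n := k) (k := a + i) (s := a) (by omega)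
  rw [Nat.add_sub_cancel_left] at h
  have h' : (k.choose (a + i) : ℝ) * ((a + i).choose a : ℝ) =
      k.choose a * (k - a).choose i := by exact_mod_cast h
  rw [Nat.add_sub_cancel_left, show k - (a + i) = k - a - i by omega, pow_add, div_pow, div_pow,
    div_pow, one_pow]
  have hbi : b ^ i ≠ 0 := by positivity
  calc _ = ((k.choose (a + i) : ℝ) * ((a + i).choose a : ℝ)) * K ^ (k - a - i) * b ^ a *
        (b ^ i * (θ ^ i / b ^ i)) * (1 / 2 ^ a) := by ring
    _ = _ := by
      rw [h', mul_div_cancel₀ _ hbi]; ring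

lemma binom_id0 (k : ℕ) (K θ b : ℝ) (hb : 0 < b) :
    ∑ c ∈ Finset.Icc 1 k, (k.choose c : ℝ) * K ^ (k - c) * b ^ c * (θ / b) ^ c =
      (K + θ) ^ k - K ^ k := by
  have hs : Finset.range (k + 1) = insert 0 (Finset.Icc 1 k) := by
    ext x; simp only [Finset.mem_range, Finset.mem_insert, Finset.mem_Icc]; omega
  rw [add_comm K θ, add_pow, hs, Finset.sum_insert (by simp)]
  simp only [pow_zero, one_mul, Nat.sub_zero, Nat.choose_zero_right, Nat.cast_one, mul_one,
    add_sub_cancel_left]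
  apply Finset.sum_congr rfl
  intro c _
  rw [div_pow]
  have : b ^ c ≠ 0 := by positivity
  field_simp

/-- chosen set -/
def Cset (ω : V ⊕ V → Bool) : Finset V := Finset.univ.filter (fun v => ω (Sum.inl v) = true)

/-- unblocked -/
def unb (H : Finset (Finset V)) (v : V) (ω : V ⊕ V → Bool) : Prop :=
  nb (H.filter (fun f => v ∈ f)) v ω

open Classical in
/-- remaining vertices -/
noncomputable def Vrem (k : ℕ) (U : Finset V) (H : Finset (Finset V)) (D : ℕ → ℝ)
    (ω : V ⊕ V → Bool) : Finset V :=
  U.filter (fun v => (ω (Sum.inl v) = false ∧ ω (Sum.inr v) = true ∧ unb H v ω) ∧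
    ∀ a ∈ Finset.Icc 1 k, ∑ e ∈ H.filter (fun e => v ∈ e), ind (Aev H v a e ω) ≤ D a)

open Classical in
/-- new independent vertices -/
noncomputable def Inew (U : Finset V) (H : Finset (Finset V)) (ω : V ⊕ V → Bool) : Finset V :=
  U.filter (fun v => ω (Sum.inl v) = true ∧ unb H v ω)

open Classical in
lemma det_step {k : ℕ} {U : Finset V} {H : Finset (Finset V)} {K b K' b' φ : ℝ}
    (hc : Cls k U H K b)
    (ih : ∀ (U' : Finset V) (H' : Finset (Finset V)), Cls k U' H' K' b' → ∃ I ⊆ U', Ind H' I ∧ φ * U'.card ≤ (I.card : ℝ))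
    (ω : V ⊕ V → Bool) :
    ∃ I ⊆ U, Ind H I ∧ ((Inew U H ω).card : ℝ) + φ *
      (Vrem k U H (fun a => k.choose a * K' ^ (k - a) * b' ^ a) ω).card ≤ I.card := by
  set D : ℕ → ℝ := fun a => k.choose a * K' ^ (k - a) * b' ^ a with hD
  set W := Vrem k U H D ω with hW
  set C := Cset ω with hC
  set H1 := H.filter (fun e => e \ C ⊆ W ∧ (e \ C).Nonempty) with hH1
  set H' := H1.image (fun e => e \ C) with hH'
  have memC : ∀ x, x ∈ C ↔ ω (Sum.inl x) = true := by
    intro x; simp [hC, Cset]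
  have notC : ∀ x, x ∉ C ↔ ω (Sum.inl x) = false := by
    intro x; rw [memC]; simp
  have memW : ∀ x, x ∈ W → x ∈ U ∧ ω (Sum.inl x) = false ∧ ω (Sum.inr x) = true ∧ unb H x ω ∧
      ∀ a ∈ Finset.Icc 1 k, ∑ e ∈ H.filter (fun e => x ∈ e), ind (Aev H x a e ω) ≤ D a := by
    intro x hx
    rw [hW] at hx
    unfold Vrem at hx
    simp only [Finset.mem_filter] at hx
    have := hx
    exact ⟨this.1, this.2.1.1, this.2.1.2.1, this.2.1.2.2, this.2.2⟩
  have hex : ∀ e' : Finset V, ∃ e, e' ∈ H' → e ∈ H1 ∧ e \ C = e' := by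
    intro e'
    by_cases h : e' ∈ H'
    · obtain ⟨e, he, rfl⟩ := Finset.mem_image.1 h
      exact ⟨e, fun _ => ⟨he, rfl⟩⟩
    · exact ⟨∅, fun h' => absurd h' h⟩
  choose g hg using hex
  have hH1H : ∀ e ∈ H1, e ∈ H := fun e he => (Finset.mem_filter.1 he).1
  have big : ∀ e ∈ H1, 2 ≤ (e \ C).card := by
    intro e he
    obtain ⟨heH, hsub, hne⟩ := Finset.mem_filter.1 he
    by_contra hlt
    have h1 : (e \ C).card = 1 := by
      have := Finset.card_pos.2 hne
      omega
    obtain ⟨x, hx⟩ := Finset.card_eq_one.1 h1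
    have hxm : x ∈ e \ C := by rw [hx]; simp
    have hxW := memW x (hsub hxm)
    apply hxW.2.2.2.1 e (Finset.mem_filter.2 ⟨heH, (Finset.mem_sdiff.1 hxm).1⟩)
    intro y hy
    rw [Finset.mem_erase] at hy
    rw [← memC]
    by_contra hyC
    have : y ∈ e \ C := Finset.mem_sdiff.2 ⟨hy.2, hyC⟩
    rw [hx, Finset.mem_singleton] at this
    exact hy.1 this
  have hcls' : Cls k W H' K' b' := by
    refine ⟨?_, ?_, ?_, ?_, ?_⟩
    · apply hc.acyc.shrink g
      · exact fun e he => hH1H _ (hg e he).1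
      · intro e he
        conv_lhs => rw [← (hg e he).2]
        exact Finset.sdiff_subset
      · intro e he f hf hne h
        apply hne
        rw [← (hg e he).2, ← (hg f hf).2, h]
    · intro e' he'
      obtain ⟨e, he, rfl⟩ := Finset.mem_image.1 he'
      exact (Finset.mem_filter.1 he).2.1
    · intro e' he'
      obtain ⟨e, he, rfl⟩ := Finset.mem_image.1 he'
      exact big e he
    · intro e' he'
      obtain ⟨e, he, rfl⟩ := Finset.mem_image.1 he'
      exact (Finset.card_le_card Finset.sdiff_subset).trans (hc.le e (hH1H e he))
    · intro v hv a ha1 hak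
      have hvW := memW v hv
      refine le_trans ?_ (hvW.2.2.2.2 a (Finset.mem_Icc.2 ⟨ha1, hak⟩))
      have e1 : ∑ e ∈ H.filter (fun e => v ∈ e), ind (Aev H v a e ω) =
          (((H.filter (fun e => v ∈ e)).filter (fun e => Aev H v a e ω)).card : ℝ) := by
        rw [Finset.card_filter]
        push_cast
        apply Finset.sum_congr rfl
        intro e _
        unfold ind
        congr
      rw [e1]
      norm_cast
      apply Finset.card_le_card_of_injOn g
      · intro e' he'
        have he' := Finset.mem_filter.1 (Finset.mem_coe.1 he')
        obtain ⟨h1, h2⟩ := hg e' he'.1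
        obtain ⟨h3, h4, h5⟩ := Finset.mem_filter.1 h1
        have hve : v ∈ g e' \ C := by rw [h2]; exact he'.2.1
        have hvC := (Finset.mem_sdiff.1 hve).2
        apply Finset.mem_coe.2
        refine Finset.mem_filter.2 ⟨Finset.mem_filter.2 ⟨h3, (Finset.mem_sdiff.1 hve).1⟩, ?_, ?_⟩
        · intro w hw
          rw [Finset.mem_erase] at hw
          by_cases hwC : w ∈ C
          · left; exact (memC w).1 hwC
          · right
            have hwW := memW w (h4 (Finset.mem_sdiff.2 ⟨hw.2, hwC⟩))
            refine ⟨hwW.2.1, hwW.2.2.1, ?_⟩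
            intro f hf
            have hf := Finset.mem_filter.1 hf
            exact hwW.2.2.2.1 f (Finset.mem_filter.2 ⟨hf.1, hf.2.1⟩)
        · have e2 : ((g e').erase v).filter (fun w => ω (Sum.inl w) = false) =
              e'.erase v := by
            ext w
            have hw2 : w ∈ e' ↔ w ∈ g e' ∧ w ∉ C := by rw [← Finset.mem_sdiff, h2]
            simp only [Finset.mem_filter, Finset.mem_erase, ← notC, hw2]
            tauto
          rw [e2, Finset.card_erase_of_mem he'.2.1, he'.2.2]
          omega
      · intro e he f hf h
        have he := (Finset.mem_filter.1 (Finset.mem_coe.1 he)).1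
        have hf := (Finset.mem_filter.1 (Finset.mem_coe.1 hf)).1
        rw [← (hg e he).2, ← (hg f hf).2, h]
  obtain ⟨I', hI'sub, hI'ind, hI'card⟩ := ih W H' hcls'
  have hInC : ∀ x ∈ Inew U H ω, x ∈ C ∧ unb H x ω := by
    intro x hx
    have := (Finset.mem_filter.1 hx).2
    exact ⟨(memC x).2 this.1, this.2⟩
  have hI'C : ∀ x ∈ I', x ∉ C := fun x hx => (notC x).2 (memW x (hI'sub hx)).2.1
  refine ⟨Inew U H ω ∪ I', ?_, ?_, ?_⟩
  · apply Finset.union_subset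
    · exact Finset.filter_subset _ _
    · exact fun x hx => (memW x (hI'sub hx)).1
  · intro e he hsub
    have hsub2 : e \ C ⊆ I' := by
      intro x hx
      rw [Finset.mem_sdiff] at hx
      rcases Finset.mem_union.1 (hsub hx.1) with h | h
      · exact absurd (hInC x h).1 hx.2
      · exact h
    by_cases hne : (e \ C).Nonempty
    · have : e \ C ∈ H' := Finset.mem_image.2
        ⟨e, Finset.mem_filter.2 ⟨he, hsub2.trans hI'sub, hne⟩, rfl⟩
      exact hI'ind _ this hsub2
    · have hall : ∀ x ∈ e, x ∈ C := by
        intro x hx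
        by_contra hxC
        exact hne ⟨x, Finset.mem_sdiff.2 ⟨hx, hxC⟩⟩
      have h2 := hc.two e he
      obtain ⟨x, hx⟩ : e.Nonempty := Finset.card_pos.1 (by omega)
      rcases Finset.mem_union.1 (hsub hx) with h | h
      · apply (hInC x h).2 e (Finset.mem_filter.2 ⟨he, hx⟩)
        intro y hy
        exact (memC y).1 (hall y (Finset.mem_of_mem_erase hy))
      · exact hI'C x h (hall x hx)
  · rw [Finset.card_union_of_disjoint]
    · push_cast
      linarith
    · rw [Finset.disjoint_left]
      intro x hx hx'
      exact hI'C x hx' (hInC x hx).1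

lemma one_sub_sum_le {κ : Type*} (s : Finset κ) (f : κ → ℝ) (h0 : ∀ i ∈ s, 0 ≤ f i)
    (h1 : ∀ i ∈ s, f i ≤ 1) : 1 - ∑ i ∈ s, f i ≤ ∏ i ∈ s, (1 - f i) := by
  classical
  induction s using Finset.induction_on with
  | empty => simp
  | insert a s ha ih =>
    rw [Finset.sum_insert ha, Finset.prod_insert ha]
    have i1 := ih (fun i hi => h0 i (Finset.mem_insert_of_mem hi))
      (fun i hi => h1 i (Finset.mem_insert_of_mem hi))
    have a0 := h0 a (Finset.mem_insert_self _ _)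
    have a1 := h1 a (Finset.mem_insert_self _ _)
    have s0 : 0 ≤ ∑ i ∈ s, f i := Finset.sum_nonneg fun i hi => h0 i (Finset.mem_insert_of_mem hi)
    have := mul_le_mul_of_nonneg_left i1 (sub_nonneg.2 a1)
    nlinarith

lemma Pu_half {k : ℕ} {U : Finset V} {H : Finset (Finset V)} {K b θ : ℝ}
    (hc : Cls k U H K b) (hb : 0 < b) (hθ : 0 ≤ θ) (hθb : θ ≤ b)
    (hpow : (K + θ) ^ k - K ^ k ≤ 1 / 2) (w : V) : 1 / 2 ≤ Pu H (θ / b) w := by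
  have hp0 : 0 ≤ θ / b := by positivity
  have hp1 : θ / b ≤ 1 := by rw [div_le_one hb]; exact hθb
  by_cases hw : w ∈ U
  · have h1 := hc.deg_sum hw (fun a => (θ / b) ^ a) (fun a => by positivity)
    rw [binom_id0 k K θ b hb] at h1
    have h2 : 1 - ∑ f ∈ H.filter (fun f => w ∈ f), (θ / b) ^ (f.card - 1) ≤ Pu H (θ / b) w := by
      unfold Pu
      apply one_sub_sum_le
      · intro i _; positivity
      · intro i _; exact pow_le_one₀ hp0 hp1
    linarith
  · have : H.filter (fun f => w ∈ f) = ∅ := by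
      rw [Finset.filter_eq_empty_iff]
      intro f hf hwf
      exact hw (hc.sub f hf hwf)
    unfold Pu
    rw [this]
    norm_num

theorem step {k : ℕ} {U : Finset V} {H : Finset (Finset V)} {K b θ δ φ : ℝ}
    (hc : Cls k U H K b) (hK : 0 ≤ K) (hb : 2 ≤ b) (hθ : 0 ≤ θ) (hθb : θ < b)
    (hpow : (K + θ) ^ k - K ^ k ≤ 1 / 2) (hK' : 1 / 2 ≤ K + θ) (hδ : 0 < δ) (hφ : 0 ≤ φ)
    (ih : ∀ (U' : Finset V) (H' : Finset (Finset V)), Cls k U' H' (K + θ) (b * (1 + δ) / 2) →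
      ∃ I ⊆ U', Ind H' I ∧ φ * U'.card ≤ (I.card : ℝ)) :
    ∃ I ⊆ U, Ind H I ∧ (θ / b / 2 + φ * ((1 - θ / b) / 2 - k * 2 ^ (k + 1) / (δ ^ 2 * b))) *
      U.card ≤ (I.card : ℝ) := by
  classical
  have hb0 : 0 < b := by linarith
  have hp0 : 0 ≤ θ / b := by positivity
  have hp1 : θ / b < 1 := by rw [div_lt_one hb0]; exact hθb
  set p := θ / b with hp
  have hPu : ∀ w, 1 / 2 ≤ Pu H p w := Pu_half hc hb0 hθ hθb.le hpow
  have hq0 : ∀ i, 0 ≤ qf H p i := by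
    rintro (v | v)
    · exact hp0
    · have := hPu v
      show 0 ≤ (1 / 2) / Pu H p v
      positivity
  have hq1 : ∀ i, qf H p i ≤ 1 := by
    rintro (v | v)
    · exact hp1.le
    · have := hPu v
      show (1 / 2) / Pu H p v ≤ 1
      rw [div_le_one (by linarith)]; exact this
  set D : ℕ → ℝ := fun a => k.choose a * (K + θ) ^ (k - a) * (b * (1 + δ) / 2) ^ a with hD
  obtain ⟨ω, hω⟩ := exists_ge_Ex hq0 hq1
    (fun ω => ((Inew U H ω).card : ℝ) + φ * (Vrem k U H D ω).card)
  obtain ⟨I, hIU, hInd, hI⟩ := det_step hc ih ω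
  refine ⟨I, hIU, hInd, le_trans ?_ (hω.trans hI)⟩
  -- expectation estimates
  rw [Ex_add, Ex_const_mul]
  have hI1 : p / 2 * U.card ≤ Ex (qf H p) (fun ω => ((Inew U H ω).card : ℝ)) := by
    have e1 : (fun ω => ((Inew U H ω).card : ℝ)) =
        fun ω => ∑ v ∈ U, ind (ω (Sum.inl v) = true ∧ unb H v ω) := by
      funext ω
      unfold Inew
      rw [Finset.card_filter]
      push_cast
      apply Finset.sum_congr rfl
      intro v _
      unfold ind
      congr
    rw [e1, Ex_sum, mul_comm, ← nsmul_eq_mul, ← Finset.sum_const]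
    apply Finset.sum_le_sum
    intro v _
    unfold unb
    rw [Ex_pair, Ex_ind_true, Ex_unb hc.acyc]
    have := hPu v
    show p / 2 ≤ p * Pu H p v
    nlinarith
  have hcheb : ∀ v ∈ U, ∀ a ∈ Finset.Icc 1 k, Ex (qf H p) (fun ω => ind (¬ (∑ e ∈ H.filter
      (fun e => v ∈ e), ind (Aev H v a e ω) ≤ D a))) ≤ 2 ^ (k + 1) / (δ ^ 2 * b) := by
    intro v hv a ha
    rw [Finset.mem_Icc] at ha
    set μ : ℝ := k.choose a * (K + θ) ^ (k - a) * (b / 2) ^ a with hμ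
    have hμlow : b / 2 ^ (k + 1) ≤ μ := by
      have c1 : (1 : ℝ) ≤ k.choose a := by exact_mod_cast Nat.choose_pos ha.2
      have c2 : (1 / 2 : ℝ) ^ k ≤ (K + θ) ^ (k - a) := by
        calc (1 / 2 : ℝ) ^ k ≤ (1 / 2) ^ (k - a) :=
              pow_le_pow_of_le_one (by norm_num) (by norm_num) (by omega)
          _ ≤ (K + θ) ^ (k - a) := pow_le_pow_left₀ (by norm_num) hK' _
      have c3 : b / 2 ≤ (b / 2) ^ a := by
        calc b / 2 = (b / 2) ^ 1 := (pow_one _).symm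
          _ ≤ (b / 2) ^ a := pow_le_pow_right₀ (by linarith) ha.1
      calc b / 2 ^ (k + 1) = 1 * (1 / 2) ^ k * (b / 2) := by
            rw [pow_succ, div_pow, one_pow]; field_simp
        _ ≤ μ := by rw [hμ]; gcongr
    have hμ0 : 0 < μ := lt_of_lt_of_le (by positivity) hμlow
    have hsum : ∑ e ∈ H.filter (fun e => v ∈ e), Ex (qf H p) (fun ω => ind (Aev H v a e ω)) ≤
        μ := by
      have h1 := hc.deg_sum hv (fun c => (c.choose a : ℝ) * p ^ (c - a) * (1 / 2) ^ a)
        (fun c => by positivity)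
      rw [binom_id k a ha.2 ha.1 K θ b hb0] at h1
      refine le_trans (Finset.sum_le_sum ?_) h1
      intro e he
      rw [Finset.mem_filter] at he
      exact Ex_Aev_le hc.acyc hp0 hp1 he.1 he.2 (hc.two e he.1) (fun w _ => hPu w) a hq0 hq1
    have hch := chebyshev hq0 hq1 (H.filter (fun e => v ∈ e)) (fun e ω => Aev H v a e ω)
      (by
        intro e he f hf hef
        rw [Finset.mem_filter] at he hf
        exact Ex_mul (Aev_dep H v a e) (Aev_dep H v a f)
          (AevS_disj hc.acyc he.1 hf.1 he.2 hf.2 hef)) μ (δ * μ) hsum (by positivity)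
    have hDa : μ + δ * μ ≤ D a := by
      have c1 : 1 + δ ≤ (1 + δ) ^ a := by
        calc 1 + δ = (1 + δ) ^ 1 := (pow_one _).symm
          _ ≤ (1 + δ) ^ a := pow_le_pow_right₀ (by linarith) ha.1
      have c2 : D a = μ * (1 + δ) ^ a := by
        simp only [hD, hμ]
        rw [show b * (1 + δ) / 2 = (b / 2) * (1 + δ) by ring, mul_pow]; ring
      rw [c2]
      nlinarith
    refine le_trans (Ex_mono hq0 hq1 ?_) (hch.trans ?_)
    · intro ω
      by_cases h : ∑ e ∈ H.filter (fun e => v ∈ e), ind (Aev H v a e ω) ≤ D a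
      · rw [ind_false (not_not.2 h)]
        exact ind_nonneg _
      · rw [ind_true h, ind_true]
        push Not at h
        linarith
    · have : μ / (δ * μ) ^ 2 = 1 / (δ ^ 2 * μ) := by field_simp
      rw [this]
      calc 1 / (δ ^ 2 * μ) ≤ 1 / (δ ^ 2 * (b / 2 ^ (k + 1))) := by gcongr
        _ = 2 ^ (k + 1) / (δ ^ 2 * b) := by field_simp
  have hV : ((1 - p) / 2 - k * 2 ^ (k + 1) / (δ ^ 2 * b)) * U.card ≤
      Ex (qf H p) (fun ω => ((Vrem k U H D ω).card : ℝ)) := by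
    have e1 : ∀ ω, ∑ v ∈ U, (ind (ω (Sum.inl v) = false ∧ ω (Sum.inr v) = true ∧ unb H v ω) -
        ∑ a ∈ Finset.Icc 1 k, ind (¬ (∑ e ∈ H.filter (fun e => v ∈ e), ind (Aev H v a e ω) ≤ D a)))
        ≤ ((Vrem k U H D ω).card : ℝ) := by
      intro ω
      unfold Vrem
      rw [Finset.card_filter]
      push_cast
      apply Finset.sum_le_sum
      intro v _
      have hnn : ∀ a ∈ Finset.Icc 1 k, 0 ≤ ind (¬ (∑ e ∈ H.filter (fun e => v ∈ e),
        ind (Aev H v a e ω) ≤ D a)) := fun a _ => ind_nonneg _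
      have hs := Finset.sum_nonneg hnn
      split_ifs with h
      · have := ind_le_one (ω (Sum.inl v) = false ∧ ω (Sum.inr v) = true ∧ unb H v ω)
        linarith
      · by_cases h1 : (ω (Sum.inl v) = false ∧ ω (Sum.inr v) = true ∧ unb H v ω)
        · have h2 : ¬ ∀ a ∈ Finset.Icc 1 k, ∑ e ∈ H.filter (fun e => v ∈ e),
            ind (Aev H v a e ω) ≤ D a := fun h2 => h ⟨h1, h2⟩
          push Not at h2
          obtain ⟨a, ha, h2⟩ := h2
          have h3 := Finset.single_le_sum hnn ha
          rw [ind_true (not_le.2 h2)] at h3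
          have := ind_le_one (ω (Sum.inl v) = false ∧ ω (Sum.inr v) = true ∧ unb H v ω)
          linarith
        · rw [ind_false h1]; linarith
    refine le_trans ?_ (Ex_mono hq0 hq1 e1)
    rw [Ex_sum, mul_comm, ← nsmul_eq_mul, ← Finset.sum_const]
    apply Finset.sum_le_sum
    intro v hv
    rw [Ex_sub, Ex_sum]
    unfold unb
    rw [Ex_three, Ex_ind_false, Ex_unb hc.acyc]
    have h1 : ((1 : ℝ) - qf H p (Sum.inl v)) * (qf H p (Sum.inr v) * Pu H p v) = (1 - p) / 2 := by
      show (1 - p) * ((1 / 2) / Pu H p v * Pu H p v) = (1 - p) / 2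
      have := hPu v
      have : Pu H p v ≠ 0 := by linarith
      field_simp
    rw [h1]
    have h2 := Finset.sum_le_sum (hcheb v hv)
    rw [Finset.sum_const, Nat.card_Icc, nsmul_eq_mul, Nat.add_sub_cancel, ← mul_div_assoc] at h2
    linarith
  nlinarith [mul_le_mul_of_nonneg_left hV hφ]

end Step
end IPPS

set_option linter.unusedSectionVars false
namespace IPPS
open Finset

/-- the sequence of parameters in the iteration -/
noncomputable def kap (k i : ℕ) : ℝ := ((i : ℝ) / 2) ^ ((1 : ℝ) / k)

lemma kap_nonneg (k i : ℕ) : 0 ≤ kap k i := by unfold kap; positivity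

lemma kap_pow {k : ℕ} (hk : 1 ≤ k) (i : ℕ) : kap k i ^ k = (i : ℝ) / 2 := by
  unfold kap
  rw [one_div]
  exact Real.rpow_inv_natCast_pow (by positivity) (by omega)

lemma kap_zero {k : ℕ} (hk : 1 ≤ k) : kap k 0 = 0 := by
  have h := kap_pow hk 0
  simp at h
  exact h.1

lemma kap_mono (k : ℕ) {i j : ℕ} (h : i ≤ j) : kap k i ≤ kap k j := by
  unfold kap
  apply Real.rpow_le_rpow (by positivity)
  · have : (i : ℝ) ≤ j := by exact_mod_cast h
    linarith
  · positivity

lemma kap_half {k : ℕ} (hk : 1 ≤ k) {i : ℕ} (hi : 1 ≤ i) : 1 / 2 ≤ kap k i := by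
  by_contra h
  push Not at h
  have h1 : kap k i ^ k < (1 / 2 : ℝ) ^ k := pow_lt_pow_left₀ h (kap_nonneg _ _) (by omega)
  rw [kap_pow hk] at h1
  have h2 : (1 / 2 : ℝ) ^ k ≤ (1 / 2) ^ 1 := pow_le_pow_of_le_one (by norm_num) (by norm_num) hk
  have : (1 : ℝ) ≤ i := by exact_mod_cast hi
  linarith

lemma kap_le {k : ℕ} (hk : 1 ≤ k) {i : ℕ} (hi : 1 ≤ i) : kap k i ≤ i := by
  by_contra h
  push Not at h
  have h1 : (i : ℝ) ^ k < kap k i ^ k := pow_lt_pow_left₀ h (by positivity) (by omega)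
  rw [kap_pow hk] at h1
  have hi' : (1 : ℝ) ≤ i := by exact_mod_cast hi
  have h2 : (i : ℝ) ^ 1 ≤ (i : ℝ) ^ k := pow_le_pow_right₀ hi' hk
  linarith

section
variable {V : Type*} [Fintype V] [DecidableEq V]

lemma nibble_aux {k T : ℕ} (hk : 1 ≤ k) (hT : 1 ≤ T) {d : ℝ}
    (hd : (k * 2 ^ (k + 3) + 2) * (T : ℝ) ^ 3 * 2 ^ T ≤ d) (j : ℕ) :
    ∀ i, i + j = T → ∀ (U : Finset V) (H : Finset (Finset V)),
      Cls k U H (kap k i) (d * ((1 + 1 / T) / 2) ^ i) → ∃ I ⊆ U, Ind H I ∧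
      ((1 - 1 / (2 * T)) / (1 + 1 / T)) ^ j * (kap k T - kap k i) /
        (2 * (d * ((1 + 1 / T) / 2) ^ i)) * U.card ≤ (I.card : ℝ) := by
  have hT' : (1 : ℝ) ≤ T := by exact_mod_cast hT
  have hT0 : (0 : ℝ) < T := by linarith
  have hd0 : 0 < d := lt_of_lt_of_le (by positivity) hd
  set γ : ℝ := (1 - 1 / (2 * T)) / (1 + 1 / T) with hγ
  have hγ0 : 0 ≤ γ := by
    apply div_nonneg
    · rw [sub_nonneg, div_le_one (by positivity)]; linarith
    · positivity
  have hγ1 : γ ≤ 1 := by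
    rw [hγ, div_le_one (by positivity)]
    have h1 : (0 : ℝ) ≤ 1 / T := by positivity
    have h2 : (0 : ℝ) ≤ 1 / (2 * T) := by positivity
    linarith
  induction j with
  | zero =>
    intro i hi U H hc
    have : i = T := by omega
    subst this
    refine ⟨∅, Finset.empty_subset _, ?_, ?_⟩
    · intro e he hs
      have h2 := hc.two e he
      rw [Finset.subset_empty.1 hs] at h2
      simp at h2
    · simp
  | succ j ih =>
    intro i hi U H hc
    set b := d * ((1 + 1 / (T : ℝ)) / 2) ^ i with hb
    set θ := kap k (i + 1) - kap k i with hθ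
    have hθ0 : 0 ≤ θ := sub_nonneg.2 (kap_mono k (by omega))
    have hθT : θ ≤ T := by
      have h1 := kap_le hk (i := i + 1) (by omega)
      have h2 := kap_nonneg k i
      have h3 : ((i + 1 : ℕ) : ℝ) ≤ T := by exact_mod_cast (by omega : i + 1 ≤ T)
      linarith
    have hbig : (k * 2 ^ (k + 3) + 2) * (T : ℝ) ^ 3 ≤ b := by
      have h1 : (1 / 2 : ℝ) ^ T ≤ ((1 + 1 / (T : ℝ)) / 2) ^ i := by
        calc (1 / 2 : ℝ) ^ T ≤ (1 / 2) ^ i :=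
              pow_le_pow_of_le_one (by norm_num) (by norm_num) (by omega)
          _ ≤ _ := by
            apply pow_le_pow_left₀ (by norm_num)
            have : (0 : ℝ) ≤ 1 / T := by positivity
            linarith
      calc (k * 2 ^ (k + 3) + 2) * (T : ℝ) ^ 3
          = ((k * 2 ^ (k + 3) + 2) * (T : ℝ) ^ 3 * 2 ^ T) * (1 / 2) ^ T := by
            rw [mul_assoc _ ((2 : ℝ) ^ T), ← mul_pow]; norm_num
        _ ≤ d * (1 / 2) ^ T := by gcongr
        _ ≤ b := by rw [hb]; gcongr
    have hT3 : (T : ℝ) ≤ (T : ℝ) ^ 3 := by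
      calc (T : ℝ) = (T : ℝ) ^ 1 := (pow_one _).symm
        _ ≤ (T : ℝ) ^ 3 := pow_le_pow_right₀ hT' (by norm_num)
    have hkk : (0 : ℝ) ≤ k * 2 ^ (k + 3) * (T : ℝ) ^ 3 := by positivity
    have hb2T : 2 * (T : ℝ) ≤ b := by nlinarith
    have hb0 : 0 < b := by linarith
    have hb' : d * ((1 + 1 / (T : ℝ)) / 2) ^ (i + 1) = b * (1 + 1 / T) / 2 := by
      rw [hb, pow_succ]; ring
    have ih' := ih (i + 1) (by omega)
    rw [hb'] at ih'
    have hKT : 0 ≤ kap k T - kap k (i + 1) := sub_nonneg.2 (kap_mono k (by omega))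
    have hKθ : kap k i + θ = kap k (i + 1) := by rw [hθ]; ring
    set φ : ℝ := γ ^ j * (kap k T - kap k (i + 1)) / (2 * (b * (1 + 1 / T) / 2)) with hφ
    have hφ0 : 0 ≤ φ := by positivity
    obtain ⟨I, hI1, hI2, hI3⟩ := step (θ := θ) (δ := 1 / T) (φ := φ) hc (kap_nonneg _ _)
      (by linarith) hθ0 (by linarith)
      (by rw [hKθ, kap_pow hk, kap_pow hk]; push_cast; linarith)
      (by rw [hKθ]; exact kap_half hk (by omega)) (by positivity) hφ0
      (by rw [hKθ]; exact ih')
    refine ⟨I, hI1, hI2, le_trans ?_ hI3⟩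
    apply mul_le_mul_of_nonneg_right _ (by positivity)
    -- main inequality
    have hE : θ / b + 2 * (k * 2 ^ (k + 1) / ((1 / (T : ℝ)) ^ 2 * b)) ≤ 1 / (2 * T) := by
      have e1 : θ / b + 2 * (k * 2 ^ (k + 1) / ((1 / (T : ℝ)) ^ 2 * b)) =
          (θ + k * 2 ^ (k + 2) * (T : ℝ) ^ 2) / b := by
        field_simp; ring
      rw [e1, div_le_div_iff₀ hb0 (by positivity), one_mul]
      refine le_trans ?_ hbig
      have e2 : (k * 2 ^ (k + 3) + 2) * (T : ℝ) ^ 3 =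
        ((k * 2 ^ (k + 2)) * (T : ℝ) ^ 2) * (2 * T) + 2 * (T : ℝ) ^ 3 := by ring
      rw [e2, add_mul, add_comm]
      have : θ * (2 * T) ≤ 2 * (T : ℝ) ^ 3 := by
        nlinarith [mul_le_mul_of_nonneg_right hθT hT0.le, mul_le_mul_of_nonneg_right hT' (sq_nonneg (T : ℝ))]
      linarith
    have hfac : γ * (1 + 1 / T) / 2 ≤ (1 - θ / b) / 2 -
        k * 2 ^ (k + 1) / ((1 / (T : ℝ)) ^ 2 * b) := by
      have : γ * (1 + 1 / T) = 1 - 1 / (2 * T) := by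
        rw [hγ]; field_simp
      rw [this]
      linarith
    have h1 : φ * (γ * (1 + 1 / T) / 2) = γ ^ (j + 1) * (kap k T - kap k (i + 1)) / (2 * b) := by
      rw [hφ, pow_succ]; field_simp
    have h2 : γ ^ (j + 1) * θ / (2 * b) ≤ θ / b / 2 := by
      rw [div_div, mul_comm b 2]
      apply div_le_div_of_nonneg_right _ (by positivity)
      have := pow_le_one₀ (n := j + 1) hγ0 hγ1
      nlinarith
    calc γ ^ (j + 1) * (kap k T - kap k i) / (2 * b)
        = γ ^ (j + 1) * θ / (2 * b) + γ ^ (j + 1) * (kap k T - kap k (i + 1)) / (2 * b) := by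
          rw [hθ]; ring
      _ ≤ θ / b / 2 + φ * (γ * (1 + 1 / T) / 2) := by rw [h1]; linarith
      _ ≤ _ := by gcongr

lemma gam_pow {T : ℕ} (hT : 1 ≤ T) : (1 / 6 : ℝ) ≤ ((1 - 1 / (2 * T)) / (1 + 1 / T)) ^ T := by
  have hT' : (1 : ℝ) ≤ T := by exact_mod_cast hT
  have hT0 : (0 : ℝ) < T := by linarith
  rw [div_pow, le_div_iff₀ (by positivity)]
  have h1 : (1 + 1 / (T : ℝ)) ^ T ≤ 3 := by
    have h := Real.add_one_le_exp (1 / (T : ℝ))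
    calc (1 + 1 / (T : ℝ)) ^ T ≤ (Real.exp (1 / T)) ^ T := by
          apply pow_le_pow_left₀ (by positivity); linarith
      _ = Real.exp 1 := by rw [← Real.exp_nat_mul]; congr 1; field_simp
      _ ≤ 3 := by have := Real.exp_one_lt_d9; linarith
  have h2 : (1 / 2 : ℝ) ≤ (1 - 1 / (2 * (T : ℝ))) ^ T := by
    have h3 : 1 / (2 * (T : ℝ)) ≤ 1 := by rw [div_le_one (by positivity)]; linarith
    have h := one_add_mul_le_pow (a := - (1 / (2 * (T : ℝ)))) (by linarith) T
    have e : (1 : ℝ) + T * (-(1 / (2 * (T : ℝ)))) = 1 / 2 := by field_simp; norm_num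
    rw [e] at h
    rwa [sub_eq_add_neg]
  linarith

lemma nibble {k T : ℕ} (hk : 1 ≤ k) (hT : 1 ≤ T) {d : ℝ}
    (hd : (k * 2 ^ (k + 3) + 2) * (T : ℝ) ^ 3 * 2 ^ T ≤ d) (U : Finset V) (H : Finset (Finset V))
    (hc : Cls k U H 0 d) : ∃ I ⊆ U, Ind H I ∧ 1 / 12 * kap k T / d * U.card ≤ (I.card : ℝ) := by
  have hT' : (1 : ℝ) ≤ T := by exact_mod_cast hT
  have hd0 : 0 < d := lt_of_lt_of_le (by positivity) hd
  obtain ⟨I, h1, h2, h3⟩ := nibble_aux hk hT hd T 0 (by omega) U H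
    (by rw [kap_zero hk]; simpa using hc)
  refine ⟨I, h1, h2, le_trans ?_ h3⟩
  apply mul_le_mul_of_nonneg_right _ (by positivity)
  rw [kap_zero hk, pow_zero, mul_one, sub_zero]
  have h4 := gam_pow hT
  have h5 := kap_nonneg k T
  calc 1 / 12 * kap k T / d = 1 / 6 * kap k T / (2 * d) := by ring
    _ ≤ _ := by gcongr

end

theorem hyper {k : ℕ} (hk : 1 ≤ k) : ∃ c : ℝ, 0 < c ∧ ∃ d0 : ℝ, ∀ d : ℝ, d0 ≤ d →
    ∀ (V : Type) [Fintype V] [DecidableEq V] (U : Finset V) (H : Finset (Finset V)),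
    Cls k U H 0 d → ∃ I ⊆ U, Ind H I ∧ c * Real.log d ^ ((1 : ℝ) / k) / d * U.card ≤ (I.card : ℝ) := by
  set C : ℝ := k * 2 ^ (k + 3) + 2 with hC
  have hC0 : 0 < C := by positivity
  have ho := (isLittleO_log_rpow_rpow_atTop 3 (by norm_num : (0 : ℝ) < 1 / 2)).bound
    (by positivity : 0 < 1 / C)
  obtain ⟨d1, hd1⟩ := Filter.eventually_atTop.1 ho
  refine ⟨1 / 12 * (1 / 8) ^ ((1 : ℝ) / k), by positivity, max d1 (Real.exp 4), ?_⟩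
  intro d hd V _ _ U H hc
  have hde : Real.exp 4 ≤ d := (le_max_right _ _).trans hd
  have hd0 : 0 < d := (Real.exp_pos 4).trans_le hde
  have hlog : 4 ≤ Real.log d := by rwa [Real.le_log_iff_exp_le hd0]
  have h1 := hd1 d ((le_max_left _ _).trans hd)
  rw [Real.norm_of_nonneg (by positivity), Real.norm_of_nonneg (by positivity)] at h1
  set T := ⌊Real.log d / 2⌋₊ with hT
  have hTle : (T : ℝ) ≤ Real.log d / 2 := Nat.floor_le (by linarith)
  have hTlt : Real.log d / 2 < T + 1 := Nat.lt_floor_add_one _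
  have hT1 : 1 ≤ T := Nat.le_floor (by push_cast; linarith)
  have h2T : (2 : ℝ) ^ T ≤ d ^ (1 / 2 : ℝ) := by
    calc (2 : ℝ) ^ T ≤ (Real.exp 1) ^ T := by
          apply pow_le_pow_left₀ (by norm_num)
          have := Real.add_one_le_exp 1; linarith
      _ = Real.exp T := by rw [← Real.exp_nat_mul, mul_one]
      _ ≤ Real.exp (Real.log d / 2) := Real.exp_le_exp.2 hTle
      _ = d ^ (1 / 2 : ℝ) := by rw [Real.rpow_def_of_pos hd0]; congr 1; ring
  have hmain : C * (T : ℝ) ^ 3 * 2 ^ T ≤ d := by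
    have h3 : (T : ℝ) ^ 3 ≤ Real.log d ^ (3 : ℝ) := by
      rw [show (3 : ℝ) = ((3 : ℕ) : ℝ) by norm_num, Real.rpow_natCast]
      exact pow_le_pow_left₀ (by positivity) (by linarith) 3
    calc C * (T : ℝ) ^ 3 * 2 ^ T ≤ C * (1 / C * d ^ (1 / 2 : ℝ)) * d ^ (1 / 2 : ℝ) := by
          gcongr
          exact h3.trans h1
      _ = d ^ (1 / 2 : ℝ) * d ^ (1 / 2 : ℝ) := by field_simp
      _ = d := by rw [← Real.rpow_add hd0]; norm_num
  obtain ⟨I, hI1, hI2, hI3⟩ := nibble hk hT1 hmain U H hc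
  refine ⟨I, hI1, hI2, le_trans ?_ hI3⟩
  have h5 : (1 / 8 : ℝ) ^ ((1 : ℝ) / k) * Real.log d ^ ((1 : ℝ) / k) ≤ kap k T := by
    rw [← Real.mul_rpow (by norm_num) (by linarith)]
    unfold kap
    apply Real.rpow_le_rpow (by positivity) (by linarith) (by positivity)
  rw [mul_assoc (1 / 12 : ℝ)]
  gcongr

end IPPS

set_option linter.unusedSectionVars false
namespace IPPS
open Finset

section Comb
variable {α : Type*} [DecidableEq α]

lemma size_arith {s t : ℕ} (h : s ≤ t + 1) : s + s * (t + 1 - s) ≤ t ^ 2 / 4 + t + 1 := by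
  have key : 4 * (s + s * (t + 1 - s)) ≤ t ^ 2 + 4 * t + 4 := by
    obtain ⟨m, hm⟩ := Nat.exists_eq_add_of_le h
    have : t + 1 - s = m := by omega
    rw [this]
    zify at hm ⊢
    have : (t : ℤ) = s + m - 1 := by linarith
    rw [this]
    nlinarith [sq_nonneg ((s : ℤ) - m - 1)]
  omega

/-- A failure of the identifying property yields a small dense subfamily. -/
lemma bad_of_not_ipps {H : Finset (Finset α)} {t r : ℕ} (hr : 1 ≤ r)
    (hH : ∀ A ∈ H, A.card = r) {X : Finset α} (hX : X.card = r)
    (hex : ∃ P ⊆ H, P.card ≤ t ∧ X ⊆ P.sup id)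
    (hno : ∀ A ∈ H, ∃ P ⊆ H, P.card ≤ t ∧ X ⊆ P.sup id ∧ A ∉ P) :
    ∃ F ⊆ H, 2 ≤ F.card ∧ F.card ≤ t ^ 2 / 4 + t + 1 ∧ (F.sup id).card + r ≤ F.card * r := by
  classical
  set PP : Finset (Finset (Finset α)) := H.powerset.filter (fun P => P.card ≤ t ∧ X ⊆ P.sup id)
    with hPP
  have memPP : ∀ P, P ∈ PP ↔ P ⊆ H ∧ P.card ≤ t ∧ X ⊆ P.sup id := by
    intro P; simp [hPP]
  set good : Finset (Finset (Finset (Finset α))) :=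
    PP.powerset.filter (fun Q => Q.Nonempty ∧ ∀ A ∈ H, ∃ P ∈ Q, A ∉ P) with hgood
  have memg : ∀ Q, Q ∈ good ↔ Q ⊆ PP ∧ Q.Nonempty ∧ ∀ A ∈ H, ∃ P ∈ Q, A ∉ P := by
    intro Q; simp [hgood]
  have hgne : good.Nonempty := by
    refine ⟨PP, (memg PP).2 ⟨Finset.Subset.refl _, ?_, ?_⟩⟩
    · obtain ⟨P, h1, h2, h3⟩ := hex
      exact ⟨P, (memPP P).2 ⟨h1, h2, h3⟩⟩
    · intro A hA
      obtain ⟨P, h1, h2, h3, h4⟩ := hno A hA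
      exact ⟨P, (memPP P).2 ⟨h1, h2, h3⟩, h4⟩
  obtain ⟨Q, hQ, hmin⟩ := Finset.exists_min_image good Finset.card hgne
  obtain ⟨hQP, hQne, hQno⟩ := (memg Q).1 hQ
  have hXne : X.Nonempty := Finset.card_pos.1 (by omega)
  -- members
  have hPsub : ∀ P ∈ Q, P ⊆ H := fun P hP => ((memPP P).1 (hQP hP)).1
  have hPt : ∀ P ∈ Q, P.card ≤ t := fun P hP => ((memPP P).1 (hQP hP)).2.1
  have hPX : ∀ P ∈ Q, ∀ x ∈ X, ∃ A ∈ P, x ∈ A := by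
    intro P hP x hx
    have := ((memPP P).1 (hQP hP)).2.2 hx
    simpa [Finset.mem_sup] using this
  set F := Q.biUnion id with hF
  have memF : ∀ A, A ∈ F ↔ ∃ P ∈ Q, A ∈ P := by intro A; simp [hF]
  have hFH : F ⊆ H := by
    intro A hA
    obtain ⟨P, hP, hAP⟩ := (memF A).1 hA
    exact hPsub P hP hAP
  -- every point of X is covered at least twice
  have htwo : ∀ x ∈ X, ∃ A ∈ F, ∃ B ∈ F, A ≠ B ∧ x ∈ A ∧ x ∈ B := by
    intro x hx
    obtain ⟨P, hP⟩ := hQne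
    obtain ⟨A, hA, hxA⟩ := hPX P hP x hx
    obtain ⟨P', hP', hAP'⟩ := hQno A (hPsub P hP hA)
    obtain ⟨B, hB, hxB⟩ := hPX P' hP' x hx
    refine ⟨A, (memF A).2 ⟨P, hP, hA⟩, B, (memF B).2 ⟨P', hP', hB⟩, ?_, hxA, hxB⟩
    rintro rfl
    exact hAP' hB
  have hF2 : 2 ≤ F.card := by
    obtain ⟨x, hx⟩ := hXne
    obtain ⟨A, hA, B, hB, hAB, -⟩ := htwo x hx
    exact Finset.one_lt_card.2 ⟨A, hA, B, hB, hAB⟩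
  -- |Q| at least 2
  have hQ2 : 2 ≤ Q.card := by
    by_contra hlt
    have h1 : Q.card = 1 := by
      have := Finset.card_pos.2 hQne
      omega
    obtain ⟨P, hP⟩ := Finset.card_eq_one.1 h1
    have hPQ : P ∈ Q := by rw [hP]; simp
    obtain ⟨x, hx⟩ := hXne
    obtain ⟨A, hA, hxA⟩ := hPX P hPQ x hx
    obtain ⟨P', hP', hAP'⟩ := hQno A (hPsub P hPQ hA)
    rw [hP, Finset.mem_singleton] at hP'
    subst hP'
    exact hAP' hA
  have hAex : ∀ P : Finset (Finset α), ∃ A : Finset α, P ∈ Q → (A ∉ P ∧ ∀ P' ∈ Q, P' ≠ P → A ∈ P') := by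
    intro P
    by_cases hP : P ∈ Q
    · have hng : Q.erase P ∉ good := by
        intro hg
        have := hmin _ hg
        rw [Finset.card_erase_of_mem hP] at this
        omega
      have hsub : Q.erase P ⊆ PP := (Finset.erase_subset _ _).trans hQP
      have hne : (Q.erase P).Nonempty := Finset.card_pos.1 (by
        rw [Finset.card_erase_of_mem hP]; omega)
      have : ∃ A ∈ H, ∀ P' ∈ Q.erase P, A ∈ P' := by
        by_contra hcon
        push Not at hcon
        exact hng ((memg _).2 ⟨hsub, hne, hcon⟩)
      obtain ⟨A, hAH, hA⟩ := this
      have hA' : ∀ P' ∈ Q, P' ≠ P → A ∈ P' := fun P' h1 h2 => hA P' (Finset.mem_erase.2 ⟨h2, h1⟩)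
      refine ⟨A, fun _ => ⟨?_, hA'⟩⟩
      intro hAP
      obtain ⟨P', hP', hn⟩ := hQno A hAH
      by_cases h : P' = P
      · subst h; exact hn hAP
      · exact hn (hA' P' hP' h)
    · exact ⟨∅, fun h => absurd h hP⟩
  choose a ha using hAex
  have hinj : Set.InjOn a Q := by
    intro P hP P' hP' h
    by_contra hne
    have h1 := (ha P hP).1
    have h2 := (ha P' hP').2 P hP hne
    rw [← h] at h2
    exact h1 h2
  have hsubP : ∀ P ∈ Q, (Q.erase P).image a ⊆ P := by
    intro P hP A hA
    obtain ⟨P', hP', rfl⟩ := Finset.mem_image.1 hA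
    rw [Finset.mem_erase] at hP'
    exact (ha P' hP'.2).2 P hP hP'.1.symm
  have hcardim : ∀ P ∈ Q, ((Q.erase P).image a).card = Q.card - 1 := by
    intro P hP
    rw [Finset.card_image_of_injOn, Finset.card_erase_of_mem hP]
    exact hinj.mono (by intro x hx; exact Finset.mem_of_mem_erase (Finset.mem_coe.1 hx))
  have hst : Q.card ≤ t + 1 := by
    obtain ⟨P, hP⟩ := hQne
    have h1 := Finset.card_le_card (hsubP P hP)
    rw [hcardim P hP] at h1
    have := hPt P hP
    omega
  have hFsub : F ⊆ Q.image a ∪ Q.biUnion (fun P => P \ (Q.erase P).image a) := by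
    intro A hA
    obtain ⟨P, hP, hAP⟩ := (memF A).1 hA
    rw [Finset.mem_union]
    by_cases h : A ∈ (Q.erase P).image a
    · left
      exact Finset.image_subset_image (Finset.erase_subset _ _) h
    · right
      exact Finset.mem_biUnion.2 ⟨P, hP, Finset.mem_sdiff.2 ⟨hAP, h⟩⟩
  have hFcard : F.card ≤ Q.card + Q.card * (t + 1 - Q.card) := by
    refine (Finset.card_le_card hFsub).trans ((Finset.card_union_le _ _).trans ?_)
    apply Nat.add_le_add Finset.card_image_le
    apply Finset.card_biUnion_le_card_mul
    intro P hP
    rw [Finset.card_sdiff_of_subset (hsubP P hP), hcardim P hP]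
    have := hPt P hP
    omega
  refine ⟨F, hFH, hF2, hFcard.trans (size_arith hst), ?_⟩
  -- double counting
  have hXF : X ⊆ F.sup id := by
    intro x hx
    obtain ⟨A, hA, B, hB, hAB, hxA, hxB⟩ := htwo x hx
    exact Finset.mem_sup.2 ⟨A, hA, hxA⟩
  have hdc : ∑ A ∈ F, A.card = ∑ x ∈ F.sup id, (F.filter (fun A => x ∈ A)).card := by
    have h1 : ∀ A ∈ F, A.card = ∑ x ∈ F.sup id, if x ∈ A then 1 else 0 := by
      intro A hA
      rw [← Finset.card_filter]
      congr 1
      ext x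
      simp only [Finset.mem_filter, Finset.mem_sup, id]
      exact ⟨fun h => ⟨⟨A, hA, h⟩, h⟩, fun h => h.2⟩
    rw [Finset.sum_congr rfl h1, Finset.sum_comm]
    apply Finset.sum_congr rfl
    intro x _
    rw [Finset.card_filter]
  have hsumr : ∑ A ∈ F, A.card = F.card * r := by
    rw [Finset.sum_congr rfl (fun A hA => hH A (hFH hA)), Finset.sum_const, smul_eq_mul]
  rw [← hsumr, hdc]
  have hlow : ∀ x ∈ F.sup id, 1 + (if x ∈ X then 1 else 0) ≤ (F.filter (fun A => x ∈ A)).card := by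
    intro x hx
    split_ifs with h
    · obtain ⟨A, hA, B, hB, hAB, hxA, hxB⟩ := htwo x h
      exact Finset.one_lt_card.2 ⟨A, Finset.mem_filter.2 ⟨hA, hxA⟩, B,
        Finset.mem_filter.2 ⟨hB, hxB⟩, hAB⟩
    · obtain ⟨A, hA, hxA⟩ := Finset.mem_sup.1 hx
      exact Finset.card_pos.2 ⟨A, Finset.mem_filter.2 ⟨hA, hxA⟩⟩
  refine le_trans ?_ (Finset.sum_le_sum hlow)
  rw [Finset.sum_add_distrib, ← Finset.card_eq_sum_ones, ← Finset.card_filter]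
  apply Nat.add_le_add_left
  rw [← hX]
  apply Finset.card_le_card
  intro x hx
  exact Finset.mem_filter.2 ⟨hXF hx, hx⟩

/-- The weight of a family. -/
def wS (k r : ℕ) (S : Finset (Finset α)) : ℤ :=
  (k : ℤ) * ((S.sup id).card : ℤ) - (S.card : ℤ) * ((k : ℤ) - 1) * r

lemma wS_submod (k r : ℕ) (A B : Finset (Finset α)) :
    wS k r (A ∪ B) + wS k r (A ∩ B) ≤ wS k r A + wS k r B := by
  unfold wS
  have h1 : ((A ∪ B).card : ℤ) + (A ∩ B).card = A.card + B.card := by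
    exact_mod_cast Finset.card_union_add_card_inter A B
  have h2 : (((A ∪ B).sup id).card : ℤ) + ((A ∩ B).sup id).card ≤
      (A.sup id).card + (B.sup id).card := by
    have h3 := Finset.card_union_add_card_inter (A.sup id) (B.sup id)
    have h4 : (A ∩ B).sup id ⊆ A.sup id ∩ B.sup id := by
      apply Finset.subset_inter
      · exact Finset.sup_mono Finset.inter_subset_left
      · exact Finset.sup_mono Finset.inter_subset_right
    have h5 := Finset.card_le_card h4
    rw [Finset.sup_union]
    have h6 : A.sup id ⊔ B.sup id = A.sup id ∪ B.sup id := rfl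
    rw [h6]
    exact_mod_cast (by omega)
  have h3 := mul_le_mul_of_nonneg_left h2 (Int.natCast_nonneg k)
  have h4 : (((A ∪ B).card : ℤ) + (A ∩ B).card) * (((k : ℤ) - 1) * r) =
    (A.card + B.card) * (((k : ℤ) - 1) * r) := by rw [h1]
  linarith

/-- No dense subfamilies of bounded size. -/
def RF (k r : ℕ) (S : Finset (Finset α)) : Prop :=
  ∀ T ⊆ S, 2 ≤ T.card → T.card ≤ 4 * (k + 1) → (r : ℤ) ≤ wS k r T

lemma RF.ge {k r : ℕ} {S : Finset (Finset α)} (h : RF k r S) (hS : ∀ A ∈ S, A.card = r)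
    {T : Finset (Finset α)} (hT : T ⊆ S) (h1 : T.Nonempty) (h2 : T.card ≤ 4 * (k + 1)) :
    (r : ℤ) ≤ wS k r T := by
  by_cases h3 : 2 ≤ T.card
  · exact h T hT h3 h2
  · have h4 : T.card = 1 := by
      have := Finset.card_pos.2 h1
      omega
    obtain ⟨A, rfl⟩ := Finset.card_eq_one.1 h4
    have := hS A (hT (by simp))
    unfold wS
    simp [this]
    linarith

lemma RF.gt {k r : ℕ} (hg : Nat.gcd k r = 1) {S : Finset (Finset α)} (h : RF k r S)
    {T : Finset (Finset α)} (hT : T ⊆ S) (h1 : 2 ≤ T.card) (h2 : T.card ≤ k) :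
    (r : ℤ) + 1 ≤ wS k r T := by
  have h3 := h T hT h1 (by omega)
  rcases h3.lt_or_eq with h4 | h4
  · omega
  · exfalso
    unfold wS at h4
    have h5 : (k : ℤ) ∣ ((T.card : ℤ) - 1) * r := by
      refine ⟨(T.card : ℤ) * r - ((T.sup id).card : ℤ), ?_⟩
      linarith
    have h6 : IsCoprime (k : ℤ) r := Nat.isCoprime_iff_coprime.2 hg
    have h7 := h6.dvd_of_dvd_mul_right h5
    have h8 := Int.le_of_dvd (by omega) h7
    omega

open Classical in
/-- auxiliary hypergraph -/
noncomputable def aux (k r : ℕ) (S : Finset (Finset α)) : Finset (Finset (Finset α)) :=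
  (S.powersetCard (k + 1)).filter (fun e => wS k r e ≤ r)

lemma mem_aux {k r : ℕ} {S : Finset (Finset α)} {e : Finset (Finset α)} :
    e ∈ aux k r S ↔ e ⊆ S ∧ e.card = k + 1 ∧ wS k r e ≤ r := by
  unfold aux
  rw [Finset.mem_filter, Finset.mem_powersetCard, and_assoc]

lemma aux_acyc {k r : ℕ} (hk : 3 ≤ k) (hg : Nat.gcd k r = 1) {S : Finset (Finset α)}
    (h : RF k r S) (hS : ∀ A ∈ S, A.card = r) : Acyc (aux k r S) := by
  have glue : ∀ A B : Finset (Finset α), A ⊆ S → B ⊆ S → B.card = k + 1 → A.card ≤ 3 * (k + 1) →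
      wS k r A ≤ r → wS k r B ≤ r → (A ∩ B).Nonempty → wS k r (A ∪ B) ≤ r := by
    intro A B hA hB cB cA wA wB hne
    have h1 := wS_submod k r A B
    have h2 := h.ge hS (Finset.inter_subset_left.trans hA) hne
      ((Finset.card_le_card Finset.inter_subset_right).trans (by omega))
    linarith
  have contra : ∀ A B : Finset (Finset α), A ⊆ S → B ⊆ S → B.card = k + 1 → A.card ≤ 3 * (k + 1) →
      wS k r A ≤ r → wS k r B ≤ r → 2 ≤ (A ∩ B).card → (A ∩ B).card ≤ k → False := by
    intro A B hA hB cB cA wA wB h2 hk'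
    have h1 := wS_submod k r A B
    have h3 := h.gt hg (Finset.inter_subset_left.trans hA) h2 hk'
    have h4 := h (A ∪ B) (Finset.union_subset hA hB)
      (h2.trans (Finset.card_le_card (Finset.inter_subset_left.trans Finset.subset_union_left)))
      ((Finset.card_union_le _ _).trans (by omega))
    linarith
  have c2 : ∀ e ∈ aux k r S, ∀ f ∈ aux k r S, e ≠ f → (e ∩ f).card ≤ 1 := by
    intro e he f hf hef
    by_contra hlt
    obtain ⟨e1, e2, e3⟩ := mem_aux.1 he
    obtain ⟨f1, f2, f3⟩ := mem_aux.1 hf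
    refine contra e f e1 f1 f2 (by omega) e3 f3 (by omega) ?_
    by_contra hgt
    have h5 : (e ∩ f).card = e.card :=
      le_antisymm (Finset.card_le_card Finset.inter_subset_left) (by omega)
    have h6 := Finset.eq_of_subset_of_card_le (Finset.inter_subset_left (s₁ := e) (s₂ := f)) h5.ge
    have h7 : e ⊆ f := Finset.inter_eq_left.1 h6
    exact hef (Finset.eq_of_subset_of_card_le h7 (by omega))
  refine ⟨?_, ?_, ?_⟩
  · intro e he f hf hef x y hxe hxf hye hyf
    exact Finset.card_le_one.1 (c2 e he f hf hef) x (Finset.mem_inter.2 ⟨hxe, hxf⟩) y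
      (Finset.mem_inter.2 ⟨hye, hyf⟩)
  · intro e he f hf g hg hef hfg heg x y z hxy hyz hxz xe xf yf yg zg ze
    obtain ⟨e1, e2, e3⟩ := mem_aux.1 he
    obtain ⟨f1, f2, f3⟩ := mem_aux.1 hf
    obtain ⟨g1, g2, g3⟩ := mem_aux.1 hg
    have w1 := glue e f e1 f1 f2 (by omega) e3 f3 ⟨x, Finset.mem_inter.2 ⟨xe, xf⟩⟩
    have hc := Finset.card_union_le e f
    refine contra (e ∪ f) g (Finset.union_subset e1 f1) g1 g2 (by omega) w1 g3 ?_ ?_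
    · exact Finset.one_lt_card.2 ⟨y, by simp [yf, yg], z, by simp [ze, zg], hyz⟩
    · rw [Finset.union_inter_distrib_right]
      have := Finset.card_union_le (e ∩ g) (f ∩ g)
      have := c2 e he g hg heg
      have := c2 f hf g hg hfg
      omega
  · intro e he f hf g hg i hi nef neg nei nfg nfi ngi x y z w mxy mxz mxw myz myw mzw
      xe xf yf yg zg zi wi we
    obtain ⟨e1, e2, e3⟩ := mem_aux.1 he
    obtain ⟨f1, f2, f3⟩ := mem_aux.1 hf
    obtain ⟨g1, g2, g3⟩ := mem_aux.1 hg
    obtain ⟨i1, i2, i3⟩ := mem_aux.1 hi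
    have w1 := glue e f e1 f1 f2 (by omega) e3 f3 ⟨x, Finset.mem_inter.2 ⟨xe, xf⟩⟩
    have hc := Finset.card_union_le e f
    have w2 := glue (e ∪ f) g (Finset.union_subset e1 f1) g1 g2 (by omega) w1 g3
      ⟨y, by simp [yf, yg]⟩
    have hc2 := Finset.card_union_le (e ∪ f) g
    refine contra (e ∪ f ∪ g) i (Finset.union_subset (Finset.union_subset e1 f1) g1) i1 i2
      (by omega) w2 i3 ?_ ?_
    · exact Finset.one_lt_card.2 ⟨z, by simp [zg, zi], w, by simp [we, wi], mzw⟩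
    · rw [Finset.union_inter_distrib_right, Finset.union_inter_distrib_right]
      have := Finset.card_union_le (e ∩ i ∪ f ∩ i) (g ∩ i)
      have := Finset.card_union_le (e ∩ i) (f ∩ i)
      have := c2 e he i hi nei
      have := c2 f hf i hi nfi
      have := c2 g hg i hi ngi
      omega

lemma ipps_of_ind {t r : ℕ} (hr : 1 ≤ r) {S I : Finset (Finset α)}
    (h : RF (t ^ 2 / 4 + t) r S) (hS : ∀ A ∈ S, A.card = r) (hI : I ⊆ S)
    (hind : Ind (aux (t ^ 2 / 4 + t) r S) I) (X : Finset α) (hX : X.card = r)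
    (hex : ∃ P ⊆ I, P.card ≤ t ∧ X ⊆ P.sup id) :
    ∃ A ∈ I, ∀ P ⊆ I, P.card ≤ t → X ⊆ P.sup id → A ∈ P := by
  by_contra hcon
  push Not at hcon
  obtain ⟨F, hF, h2, hu, hsp⟩ := bad_of_not_ipps hr (fun A hA => hS A (hI hA)) hX hex hcon
  set k := t ^ 2 / 4 + t with hk
  have hw : wS k r F ≤ ((F.card : ℤ) - k) * r := by
    unfold wS
    have h1 : ((F.sup id).card : ℤ) + r ≤ F.card * r := by exact_mod_cast hsp
    have h3 := mul_le_mul_of_nonneg_left h1 (Int.natCast_nonneg k)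
    linarith
  have hr' : (0 : ℤ) < r := by omega
  rcases Nat.lt_or_ge k F.card with h4 | h4
  · have h5 : F.card = k + 1 := by omega
    refine hind F (mem_aux.2 ⟨hF.trans hI, h5, ?_⟩) hF
    rw [h5] at hw
    push_cast at hw
    linarith
  · have h5 := h F (hF.trans hI) h2 (by omega)
    have h6 : ((F.card : ℤ) - k) * r ≤ 0 :=
      mul_nonpos_of_nonpos_of_nonneg (by omega) hr'.le
    linarith

lemma aux_cls [Fintype α] {k r : ℕ} (hk : 3 ≤ k) (hg : Nat.gcd k r = 1) {S : Finset (Finset α)}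
    (h : RF k r S) (hS : ∀ A ∈ S, A.card = r) {d : ℝ}
    (hdeg : ∀ v ∈ S, (((aux k r S).filter (fun e => v ∈ e)).card : ℝ) ≤ d ^ k) :
    Cls k S (aux k r S) 0 d := by
  refine ⟨aux_acyc hk hg h hS, fun e he => (mem_aux.1 he).1, ?_, ?_, ?_⟩
  · intro e he
    have := (mem_aux.1 he).2.1
    omega
  · intro e he
    exact (mem_aux.1 he).2.1.le
  · intro v hv a h1 h2
    rcases h2.lt_or_eq with h3 | h3
    · have : (aux k r S).filter (fun e => v ∈ e ∧ e.card = a + 1) = ∅ := by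
        rw [Finset.filter_eq_empty_iff]
        rintro e he ⟨-, h4⟩
        have := (mem_aux.1 he).2.1
        omega
      rw [this, zero_pow (by omega)]
      simp
    · subst h3
      simp only [Nat.choose_self, Nat.cast_one, Nat.sub_self, pow_zero, one_mul]
      refine le_trans ?_ (hdeg v hv)
      norm_cast
      apply Finset.card_le_card
      intro e he
      rw [Finset.mem_filter] at he ⊢
      exact ⟨he.1, he.2.1⟩

end Comb
end IPPS

set_option linter.unusedSectionVars false
namespace IPPS
open Finset

section Prob
variable {ι : Type*} [Fintype ι] [DecidableEq ι]

lemma random_sel (R : Finset ι) (A B : Finset (Finset ι)) (hA : ∀ e ∈ A, e ⊆ R)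
    (hB : ∀ e ∈ B, e ⊆ R) {ρ : ℝ} (h0 : 0 ≤ ρ) (h1 : ρ ≤ 1) (β : ℝ) :
    ∃ S ⊆ R, R.card * ρ - 4 * ∑ e ∈ A, ρ ^ e.card - β * ∑ e ∈ B, ρ ^ e.card ≤
      (S.card : ℝ) - 4 * (A.filter (fun e => e ⊆ S)).card - β * (B.filter (fun e => e ⊆ S)).card := by
  set q : ι → ℝ := fun _ => ρ with hq
  set Sω : (ι → Bool) → Finset ι := fun ω => R.filter (fun i => ω i = true) with hS
  have hcount : ∀ (D : Finset (Finset ι)), (∀ e ∈ D, e ⊆ R) →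
      Ex q (fun ω => ((D.filter (fun e => e ⊆ Sω ω)).card : ℝ)) = ∑ e ∈ D, ρ ^ e.card := by
    intro D hD
    have e1 : (fun ω => ((D.filter (fun e => e ⊆ Sω ω)).card : ℝ)) =
        fun ω => ∑ e ∈ D, ind (∀ i ∈ e, ω i = true) := by
      funext ω
      rw [Finset.card_filter]
      push_cast
      apply Finset.sum_congr rfl
      intro e he
      have hiff : e ⊆ Sω ω ↔ ∀ i ∈ e, ω i = true := by
        constructor
        · intro h i hi
          exact (Finset.mem_filter.1 (h hi)).2
        · intro h i hi
          exact Finset.mem_filter.2 ⟨hD e he hi, h i hi⟩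
      by_cases h : e ⊆ Sω ω
      · rw [if_pos h, ind_true (hiff.1 h)]
      · rw [if_neg h, ind_false (fun h' => h (hiff.2 h'))]
    rw [e1, Ex_sum]
    apply Finset.sum_congr rfl
    intro e _
    rw [Ex_ind_all, Finset.prod_const]
  have hcard : Ex q (fun ω => ((Sω ω).card : ℝ)) = R.card * ρ := by
    have e1 : (fun ω => ((Sω ω).card : ℝ)) = fun ω => ∑ i ∈ R, ind (ω i = true) := by
      funext ω
      simp only [hS]
      rw [Finset.card_filter]
      push_cast
      apply Finset.sum_congr rfl
      intro i _
      unfold ind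
      congr
    rw [e1, Ex_sum]
    simp only [Ex_ind_true]
    rw [Finset.sum_const, nsmul_eq_mul]
  obtain ⟨ω, hω⟩ := exists_ge_Ex (q := q) (fun _ => h0) (fun _ => h1)
    (fun ω => ((Sω ω).card : ℝ) - 4 * (A.filter (fun e => e ⊆ Sω ω)).card -
      β * (B.filter (fun e => e ⊆ Sω ω)).card)
  rw [Ex_sub, Ex_sub, Ex_const_mul, Ex_const_mul, hcount A hA, hcount B hB, hcard] at hω
  exact ⟨Sω ω, Finset.filter_subset _ _, hω⟩

lemma clean (S : Finset ι) (A B : Finset (Finset ι)) (hA : ∀ e ∈ A, e.Nonempty)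
    {u : ℕ} (hu : 1 ≤ u) (hB : ∀ e ∈ B, e.card = u) {b : ℝ} (hb : 0 < b)
    (h1 : 4 * (A.card : ℝ) ≤ S.card) (h2 : (B.card : ℝ) ≤ b * S.card) :
    ∃ S' ⊆ S, (S.card : ℝ) / 2 ≤ S'.card ∧ (∀ e ∈ A, ¬ e ⊆ S') ∧
      ∀ v ∈ S', ((B.filter (fun e => v ∈ e)).card : ℝ) ≤ 4 * u * b := by
  classical
  have hch : ∀ e : Finset ι, ∃ x : Finset ι, e ∈ A → ∃ y ∈ e, x = {y} := by
    intro e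
    by_cases he : e ∈ A
    · obtain ⟨y, hy⟩ := hA e he
      exact ⟨{y}, fun _ => ⟨y, hy, rfl⟩⟩
    · exact ⟨(∅ : Finset ι), fun h => absurd h he⟩
  choose g hg using hch
  set D1 := A.biUnion g with hD1
  have hD1c : D1.card ≤ A.card := by
    have := Finset.card_biUnion_le_card_mul A g 1 (by
      intro e he
      obtain ⟨y, -, h⟩ := hg e he
      rw [h]; simp)
    simpa using this
  set D2 := S.filter (fun v => 4 * u * b < ((B.filter (fun e => v ∈ e)).card : ℝ)) with hD2
  have hu' : (1 : ℝ) ≤ u := by exact_mod_cast hu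
  have hsum : ∑ v ∈ S, ((B.filter (fun e => v ∈ e)).card : ℝ) ≤ u * B.card := by
    have e1 : ∀ v ∈ S, ((B.filter (fun e => v ∈ e)).card : ℝ) = ∑ e ∈ B, if v ∈ e then 1 else 0 := by
      intro v _
      rw [Finset.card_filter]; push_cast; rfl
    rw [Finset.sum_congr rfl e1, Finset.sum_comm]
    have e2 : ∀ e ∈ B, (∑ v ∈ S, if v ∈ e then (1 : ℝ) else 0) ≤ u := by
      intro e he
      rw [← hB e he, ← Nat.cast_one, ← Nat.cast_zero]
      simp only [← Nat.cast_ite]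
      rw [← Nat.cast_sum, ← Finset.card_filter]
      norm_cast
      apply Finset.card_le_card
      intro v hv
      exact (Finset.mem_filter.1 hv).2
    refine (Finset.sum_le_sum e2).trans ?_
    rw [Finset.sum_const, nsmul_eq_mul, mul_comm]
  have hD2c : 4 * (D2.card : ℝ) ≤ S.card := by
    have h3 : D2.card * (4 * u * b) ≤ u * (b * S.card) := by
      calc D2.card * (4 * u * b) = ∑ v ∈ D2, 4 * u * b := by
            rw [Finset.sum_const, nsmul_eq_mul]
        _ ≤ ∑ v ∈ D2, ((B.filter (fun e => v ∈ e)).card : ℝ) :=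
            Finset.sum_le_sum fun v hv => (Finset.mem_filter.1 hv).2.le
        _ ≤ ∑ v ∈ S, ((B.filter (fun e => v ∈ e)).card : ℝ) :=
            Finset.sum_le_sum_of_subset_of_nonneg (Finset.filter_subset _ _)
              (fun _ _ _ => by positivity)
        _ ≤ u * B.card := hsum
        _ ≤ _ := by gcongr
    have hub : 0 < u * b := by positivity
    have h4 : (4 * (D2.card : ℝ)) * (u * b) ≤ S.card * (u * b) := by linarith
    exact le_of_mul_le_mul_right h4 hub
  refine ⟨S \ (D1 ∪ D2), Finset.sdiff_subset, ?_, ?_, ?_⟩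
  · have h3 := Finset.le_card_sdiff (D1 ∪ D2) S
    have h4 := Finset.card_union_le D1 D2
    have h5 : S.card ≤ (S \ (D1 ∪ D2)).card + A.card + D2.card := by omega
    have h6 : (S.card : ℝ) ≤ (S \ (D1 ∪ D2)).card + A.card + D2.card := by exact_mod_cast h5
    linarith
  · intro e he hsub
    obtain ⟨y, hy, h⟩ := hg e he
    have h3 := Finset.mem_sdiff.1 (hsub hy)
    apply h3.2
    apply Finset.mem_union_left
    exact Finset.mem_biUnion.2 ⟨e, he, by rw [h]; simp⟩
  · intro v hv
    have h3 := Finset.mem_sdiff.1 hv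
    by_contra h4
    push Not at h4
    exact h3.2 (Finset.mem_union_right _ (Finset.mem_filter.2 ⟨h3.1, h4⟩))

end Prob

lemma span_count {n m : ℕ} (hn : 1 ≤ n) (Fam : Finset (Finset (Finset (Fin n))))
    (hm : ∀ S ∈ Fam, (S.sup id).card ≤ m) :
    ∑ S ∈ Fam, (1 / (n : ℝ)) ^ (S.sup id).card ≤ (m + 1) * 2 ^ 2 ^ m := by
  classical
  have hn' : (1 : ℝ) ≤ n := by exact_mod_cast hn
  set YY : Finset (Finset (Fin n)) := Finset.univ.filter (fun Y => Y.card ≤ m) with hYY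
  have hmap : ∀ S ∈ Fam, S.sup id ∈ YY := fun S hS =>
    Finset.mem_filter.2 ⟨Finset.mem_univ _, hm S hS⟩
  rw [← Finset.sum_fiberwise_of_maps_to hmap]
  have h1 : ∀ Y ∈ YY, ∑ S ∈ Fam.filter (fun S => S.sup id = Y), (1 / (n : ℝ)) ^ (S.sup id).card ≤
      2 ^ 2 ^ m * (1 / (n : ℝ)) ^ Y.card := by
    intro Y hY
    have hYm : Y.card ≤ m := (Finset.mem_filter.1 hY).2
    have e1 : ∀ S ∈ Fam.filter (fun S => S.sup id = Y), (1 / (n : ℝ)) ^ (S.sup id).card =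
        (1 / (n : ℝ)) ^ Y.card := by
      intro S hS
      rw [(Finset.mem_filter.1 hS).2]
    rw [Finset.sum_congr rfl e1, Finset.sum_const, nsmul_eq_mul]
    apply mul_le_mul_of_nonneg_right _ (by positivity)
    have e2 : Fam.filter (fun S => S.sup id = Y) ⊆ Y.powerset.powerset := by
      intro S hS
      rw [Finset.mem_powerset]
      intro A hA
      rw [Finset.mem_powerset, ← (Finset.mem_filter.1 hS).2]
      exact Finset.le_sup (f := id) hA
    have e3 := Finset.card_le_card e2
    rw [Finset.card_powerset, Finset.card_powerset] at e3
    have e4 : 2 ^ 2 ^ Y.card ≤ 2 ^ 2 ^ m :=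
      Nat.pow_le_pow_right (by norm_num) (Nat.pow_le_pow_right (by norm_num) hYm)
    exact_mod_cast e3.trans e4
  refine (Finset.sum_le_sum h1).trans ?_
  rw [← Finset.mul_sum, mul_comm]
  apply mul_le_mul_of_nonneg_right _ (by positivity)
  have hmap2 : ∀ Y ∈ YY, Y.card ∈ Finset.range (m + 1) := fun Y hY =>
    Finset.mem_range.2 (Nat.lt_succ_of_le (Finset.mem_filter.1 hY).2)
  rw [← Finset.sum_fiberwise_of_maps_to hmap2]
  have h2 : ∀ s ∈ Finset.range (m + 1), ∑ Y ∈ YY.filter (fun Y => Y.card = s),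
      (1 / (n : ℝ)) ^ Y.card ≤ 1 := by
    intro s _
    have e1 : ∀ Y ∈ YY.filter (fun Y => Y.card = s), (1 / (n : ℝ)) ^ Y.card = (1 / (n : ℝ)) ^ s := by
      intro Y hY
      rw [(Finset.mem_filter.1 hY).2]
    rw [Finset.sum_congr rfl e1, Finset.sum_const, nsmul_eq_mul]
    have e2 : YY.filter (fun Y => Y.card = s) ⊆ Finset.univ.powersetCard s := by
      intro Y hY
      rw [Finset.mem_powersetCard]
      exact ⟨Finset.subset_univ _, (Finset.mem_filter.1 hY).2⟩
    have e3 := Finset.card_le_card e2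
    rw [Finset.card_powersetCard, Finset.card_univ, Fintype.card_fin] at e3
    have e4 := e3.trans (Nat.choose_le_pow n s)
    have e5 : ((YY.filter (fun Y => Y.card = s)).card : ℝ) ≤ (n : ℝ) ^ s := by exact_mod_cast e4
    calc _ ≤ (n : ℝ) ^ s * (1 / (n : ℝ)) ^ s := by gcongr
      _ = 1 := by rw [← mul_pow, mul_one_div_cancel (by linarith), one_pow]
  refine (Finset.sum_le_sum h2).trans ?_
  simp

end IPPS

set_option linter.unusedSectionVars false
namespace IPPS
open Finset

lemma rho_pow {n k r : ℕ} (hn : 1 ≤ n) (hk : 1 ≤ k) (ε : ℝ) (S : Finset (Finset (Fin n))) :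
    ((n : ℝ) ^ ((r : ℝ) / k - r + ε)) ^ S.card =
      (1 / (n : ℝ)) ^ (S.sup id).card * (n : ℝ) ^ ((wS k r S : ℝ) / k + S.card * ε) := by
  have hn0 : (0 : ℝ) < n := by exact_mod_cast hn
  have hk0 : (k : ℝ) ≠ 0 := by positivity
  have e1 : (1 / (n : ℝ)) ^ (S.sup id).card = (n : ℝ) ^ (-((S.sup id).card : ℝ)) := by
    rw [Real.rpow_neg hn0.le, Real.rpow_natCast, one_div, inv_pow]
  rw [e1, ← Real.rpow_add hn0, ← Real.rpow_natCast, ← Real.rpow_mul hn0.le]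
  congr 1
  unfold wS
  push_cast
  field_simp
  ring

lemma fam_sum {n k r m : ℕ} (hn : 1 ≤ n) (hk : 1 ≤ k) (ε x : ℝ)
    (Fam : Finset (Finset (Finset (Fin n)))) (hm : ∀ S ∈ Fam, (S.sup id).card ≤ m)
    (hx : ∀ S ∈ Fam, (wS k r S : ℝ) / k + S.card * ε ≤ x) :
    ∑ S ∈ Fam, ((n : ℝ) ^ ((r : ℝ) / k - r + ε)) ^ S.card ≤ ((m + 1) * 2 ^ 2 ^ m) * (n : ℝ) ^ x := by
  have hn1 : (1 : ℝ) ≤ n := by exact_mod_cast hn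
  calc ∑ S ∈ Fam, ((n : ℝ) ^ ((r : ℝ) / k - r + ε)) ^ S.card
      ≤ ∑ S ∈ Fam, (1 / (n : ℝ)) ^ (S.sup id).card * (n : ℝ) ^ x := by
        apply Finset.sum_le_sum
        intro S hS
        rw [rho_pow hn hk]
        apply mul_le_mul_of_nonneg_left _ (by positivity)
        exact Real.rpow_le_rpow_of_exponent_le hn1 (hx S hS)
    _ = (∑ S ∈ Fam, (1 / (n : ℝ)) ^ (S.sup id).card) * (n : ℝ) ^ x := by rw [Finset.sum_mul]
    _ ≤ _ := by
        apply mul_le_mul_of_nonneg_right _ (by positivity)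
        exact span_count hn Fam hm

lemma choose_low {n r : ℕ} (h : 2 * r ≤ n) :
    1 / (2 ^ r * (r.factorial : ℝ)) * (n : ℝ) ^ (r : ℝ) ≤ (n.choose r : ℝ) := by
  refine le_trans ?_ (Nat.pow_le_choose r n)
  rw [Real.rpow_natCast]
  have h1 : (n : ℝ) / 2 ≤ ((n + 1 - r : ℕ) : ℝ) := by
    have : n ≤ 2 * (n + 1 - r) := by omega
    have : (n : ℝ) ≤ 2 * ((n + 1 - r : ℕ) : ℝ) := by exact_mod_cast this
    linarith
  have hf : (0 : ℝ) < r.factorial := by exact_mod_cast Nat.factorial_pos r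
  calc 1 / (2 ^ r * (r.factorial : ℝ)) * (n : ℝ) ^ r = ((n : ℝ) / 2) ^ r / r.factorial := by
        rw [div_pow]; field_simp
    _ ≤ _ := by gcongr

lemma span_le {n r s : ℕ} {S : Finset (Finset (Fin n))} (h : ∀ A ∈ S, A.card = r)
    (hs : S.card ≤ s) : (S.sup id).card ≤ s * r := by
  rw [Finset.sup_eq_biUnion]
  refine (Finset.card_biUnion_le_card_mul S id r fun A hA => (h A hA).le).trans ?_
  exact Nat.mul_le_mul_right r hs

/-- The deterministic output of the random construction. -/
lemma construct {k r : ℕ} (hk : 3 ≤ k) (hr : 3 ≤ r) :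
    ∃ ε : ℝ, 0 < ε ∧ ∃ κ : ℝ, 0 < κ ∧ ∃ C : ℝ, 1 ≤ C ∧ ∃ N : ℕ, ∀ n : ℕ, N ≤ n →
      ∃ S : Finset (Finset (Fin n)), (∀ A ∈ S, A.card = r) ∧ RF k r S ∧
        κ * (n : ℝ) ^ ((r : ℝ) / k + ε) ≤ S.card ∧
        ∀ v ∈ S, (((aux k r S).filter (fun e => v ∈ e)).card : ℝ) ≤ C * (n : ℝ) ^ (k * ε) := by
  have hk0 : (0 : ℝ) < k := by exact_mod_cast (by omega : 0 < k)
  have hk3 : (3 : ℝ) ≤ k := by exact_mod_cast hk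
  have hr3 : (3 : ℝ) ≤ r := by exact_mod_cast hr
  set ε : ℝ := 1 / (8 * k * (k + 1)) with hε
  have hε0 : 0 < ε := by positivity
  have hεu : 4 * (k + 1) * ε = 1 / (2 * k) := by rw [hε]; field_simp; norm_num
  set κ : ℝ := 1 / (2 ^ r * (r.factorial : ℝ)) with hκ
  have hf1 : (1 : ℝ) ≤ r.factorial := by exact_mod_cast Nat.factorial_pos r
  have hκ0 : 0 < κ := by positivity
  have hκ1 : κ ≤ 1 := by
    rw [hκ, div_le_one (by positivity)]
    have : (1 : ℝ) ≤ 2 ^ r := one_le_pow₀ (by norm_num)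
    nlinarith
  set m : ℕ := 4 * (k + 1) * r with hm
  set C1 : ℝ := ((m : ℝ) + 1) * 2 ^ 2 ^ m with hC1
  have hC11 : 1 ≤ C1 := by
    have h1 : (1 : ℝ) ≤ 2 ^ 2 ^ m := one_le_pow₀ (by norm_num)
    have h2 : (0 : ℝ) ≤ m := by positivity
    nlinarith
  have hC10 : 0 < C1 := by linarith
  obtain ⟨N1, hN1⟩ := Filter.eventually_atTop.1
    (((tendsto_rpow_atTop (by positivity : 0 < 1 / (2 * (k : ℝ)) + ε)).comp
      tendsto_natCast_atTop_atTop).eventually_ge_atTop (16 * C1 / κ))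
  refine ⟨ε, hε0, κ / 4, by positivity, 16 * (k + 1) * C1 / κ, ?_, max N1 (2 * r), ?_⟩
  · rw [le_div_iff₀ hκ0]; nlinarith
  intro n hn
  have hn2 : 2 * r ≤ n := (le_max_right _ _).trans hn
  have hn1 : 1 ≤ n := by omega
  have hnr : (1 : ℝ) ≤ n := by exact_mod_cast hn1
  have hn0 : (0 : ℝ) < n := by linarith
  have hNb : 16 * C1 / κ ≤ (n : ℝ) ^ (1 / (2 * (k : ℝ)) + ε) := hN1 n ((le_max_left _ _).trans hn)
  set e0 : ℝ := (r : ℝ) / k - r + ε with he0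
  set ρ : ℝ := (n : ℝ) ^ e0 with hρ
  have hρ0 : 0 ≤ ρ := by positivity
  have he0' : e0 ≤ 0 := by
    have h1 : (r : ℝ) / k ≤ r / 3 := by gcongr
    have h2 : ε ≤ 1 := by
      rw [hε, div_le_one (by positivity)]; nlinarith
    linarith
  have hρ1 : ρ ≤ 1 := Real.rpow_le_one_of_one_le_of_nonpos hnr he0'
  set R : Finset (Finset (Fin n)) := Finset.univ.powersetCard r with hR
  have hRc : ∀ A ∈ R, A.card = r := fun A hA => (Finset.mem_powersetCard.1 hA).2
  classical
  set Rare : Finset (Finset (Finset (Fin n))) := R.powerset.filter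
    (fun T => 2 ≤ T.card ∧ T.card ≤ 4 * (k + 1) ∧ wS k r T < r) with hRare
  have memRare : ∀ T, T ∈ Rare ↔ T ⊆ R ∧ 2 ≤ T.card ∧ T.card ≤ 4 * (k + 1) ∧ wS k r T < r := by
    intro T
    rw [hRare, Finset.mem_filter, Finset.mem_powerset]
  set Bad := aux k r R with hBad
  set M : ℝ := κ * (n : ℝ) ^ ((r : ℝ) / k + ε) with hM
  have hM0 : 0 < M := by positivity
  set x1 : ℝ := (r : ℝ) / k - 1 / (2 * k) with hx1
  set x2 : ℝ := (r : ℝ) / k + (k + 1) * ε with hx2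
  have sRare : ∑ T ∈ Rare, ρ ^ T.card ≤ C1 * (n : ℝ) ^ x1 := by
    apply fam_sum hn1 (by omega)
    · intro T hT
      obtain ⟨h1, h2, h3, h4⟩ := (memRare T).1 hT
      exact span_le (fun A hA => hRc A (h1 hA)) h3
    · intro T hT
      obtain ⟨h1, h2, h3, h4⟩ := (memRare T).1 hT
      have h5 : (wS k r T : ℝ) ≤ r - 1 := by
        have : wS k r T ≤ (r : ℤ) - 1 := by omega
        exact_mod_cast this
      have h6 : (T.card : ℝ) * ε ≤ 4 * (k + 1) * ε := by
        apply mul_le_mul_of_nonneg_right _ hε0.le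
        exact_mod_cast h3
      have h7 : (wS k r T : ℝ) / k ≤ ((r : ℝ) - 1) / k := by gcongr
      have h8 : ((r : ℝ) - 1) / k + 1 / (2 * k) = x1 := by rw [hx1]; field_simp; ring
      linarith
  have sBad : ∑ T ∈ Bad, ρ ^ T.card ≤ C1 * (n : ℝ) ^ x2 := by
    apply fam_sum hn1 (by omega)
    · intro T hT
      obtain ⟨h1, h2, h3⟩ := mem_aux.1 hT
      exact span_le (fun A hA => hRc A (h1 hA)) (by omega)
    · intro T hT
      obtain ⟨h1, h2, h3⟩ := mem_aux.1 hT
      have h5 : (wS k r T : ℝ) ≤ r := by exact_mod_cast h3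
      have h7 : (wS k r T : ℝ) / k ≤ (r : ℝ) / k := by gcongr
      rw [h2]
      push_cast
      linarith
  have hMR : M ≤ R.card * ρ := by
    rw [hR, Finset.card_powersetCard, Finset.card_univ, Fintype.card_fin]
    have h1 := mul_le_mul_of_nonneg_right (choose_low hn2) hρ0
    refine le_trans (le_of_eq ?_) h1
    rw [hM, hρ, mul_assoc, ← Real.rpow_add hn0, he0]
    congr 2
    ring
  have hx1M : 16 * (C1 * (n : ℝ) ^ x1) ≤ M := by
    have h1 : 16 * C1 ≤ (n : ℝ) ^ (1 / (2 * (k : ℝ)) + ε) * κ := (div_le_iff₀ hκ0).1 hNb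
    have h2 : M = ((n : ℝ) ^ (1 / (2 * (k : ℝ)) + ε) * κ) * (n : ℝ) ^ x1 := by
      rw [hM, mul_comm _ κ, mul_assoc, ← Real.rpow_add hn0]
      congr 2
      rw [hx1]; ring
    rw [h2, ← mul_assoc]
    exact mul_le_mul_of_nonneg_right h1 (by positivity)
  set B : ℝ := 4 * (C1 * (n : ℝ) ^ x2) / M with hB
  have hB0 : 0 < B := by positivity
  obtain ⟨S, hSR, hS⟩ := random_sel R Rare Bad (fun e he => ((memRare e).1 he).1)
    (fun e he => (mem_aux.1 he).1) hρ0 hρ1 (1 / B)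
  have hβ : 1 / B * ∑ T ∈ Bad, ρ ^ T.card ≤ M / 4 := by
    calc 1 / B * ∑ T ∈ Bad, ρ ^ T.card ≤ 1 / B * (C1 * (n : ℝ) ^ x2) := by gcongr
      _ = M / 4 := by rw [hB]; field_simp
  set a : ℝ := ((Rare.filter (fun e => e ⊆ S)).card : ℝ) with ha
  set b : ℝ := ((Bad.filter (fun e => e ⊆ S)).card : ℝ) with hb
  have ha0 : 0 ≤ a := by positivity
  have hb0 : 0 ≤ 1 / B * b := by positivity
  have hfin : M / 2 ≤ (S.card : ℝ) - 4 * a - 1 / B * b := by linarith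
  obtain ⟨S', hS'S, hS'c, hS'A, hS'B⟩ := clean S (Rare.filter (fun e => e ⊆ S))
    (Bad.filter (fun e => e ⊆ S))
    (by
      intro e he
      have := ((memRare e).1 (Finset.mem_filter.1 he).1).2.1
      exact Finset.card_pos.1 (by omega))
    (u := k + 1) (by omega)
    (fun e he => (mem_aux.1 (Finset.mem_filter.1 he).1).2.1) hB0 (by linarith)
    (by
      have h1 : 1 / B * b ≤ S.card := by linarith
      rw [one_div, inv_mul_le_iff₀ hB0] at h1
      exact h1)
  refine ⟨S', fun A hA => hRc A (hSR (hS'S hA)), ?_, by linarith, ?_⟩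
  · intro T hT h2 h4
    by_contra hlt
    push Not at hlt
    refine hS'A T (Finset.mem_filter.2 ⟨(memRare T).2 ⟨?_, h2, h4, hlt⟩, ?_⟩) hT
    · exact hT.trans (hS'S.trans hSR)
    · exact hT.trans hS'S
  · intro v hv
    have h1 : ((aux k r S').filter (fun e => v ∈ e)).card ≤
        ((Bad.filter (fun e => e ⊆ S)).filter (fun e => v ∈ e)).card := by
      apply Finset.card_le_card
      intro e he
      rw [Finset.mem_filter] at he
      obtain ⟨h1, h2, h3⟩ := mem_aux.1 he.1
      exact Finset.mem_filter.2 ⟨Finset.mem_filter.2 ⟨mem_aux.2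
        ⟨h1.trans (hS'S.trans hSR), h2, h3⟩, h1.trans hS'S⟩, he.2⟩
    have h2 := hS'B v hv
    have h3 : (((aux k r S').filter (fun e => v ∈ e)).card : ℝ) ≤
        ((Bad.filter (fun e => e ⊆ S)).filter (fun e => v ∈ e)).card := by exact_mod_cast h1
    refine h3.trans (h2.trans (le_of_eq ?_))
    have h4 : (n : ℝ) ^ x2 = (n : ℝ) ^ (k * ε) * (n : ℝ) ^ ((r : ℝ) / k + ε) := by
      rw [← Real.rpow_add hn0]
      congr 1
      rw [hx2]; ring
    have h5 : (0 : ℝ) < (n : ℝ) ^ ((r : ℝ) / k + ε) := by positivity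
    rw [hB, hM, h4]
    push_cast
    field_simp
    ring

theorem main_lemma {k r : ℕ} (hk : 3 ≤ k) (hr : 3 ≤ r) (hg : Nat.gcd k r = 1) :
    ∃ c : ℝ, 0 < c ∧ ∃ N : ℕ, ∀ n : ℕ, N ≤ n →
      ∃ S I : Finset (Finset (Fin n)), (∀ A ∈ S, A.card = r) ∧ RF k r S ∧ I ⊆ S ∧
        Ind (aux k r S) I ∧
        c * (n : ℝ) ^ ((r : ℝ) / k) * Real.log n ^ ((1 : ℝ) / k) ≤ I.card := by
  have hk0 : (0 : ℝ) < k := by exact_mod_cast (by omega : 0 < k)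
  obtain ⟨ε, hε, κ, hκ, C, hC, N1, hcon⟩ := construct hk hr
  obtain ⟨c0, hc0, d0, hhyp⟩ := hyper (k := k) (by omega)
  obtain ⟨N2, hN2⟩ := Filter.eventually_atTop.1
    (((tendsto_rpow_atTop hε).comp tendsto_natCast_atTop_atTop).eventually_ge_atTop d0)
  set C2 : ℝ := C ^ ((1 : ℝ) / k) with hC2
  have hC21 : 1 ≤ C2 := Real.one_le_rpow hC (by positivity)
  have hC20 : 0 < C2 := by linarith
  refine ⟨c0 * ε ^ ((1 : ℝ) / k) * κ / C2, by positivity, max (max N1 N2) 1, ?_⟩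
  intro n hn
  have hnN1 : N1 ≤ n := (le_max_left _ _).trans ((le_max_left _ _).trans hn)
  have hnN2 : N2 ≤ n := (le_max_right _ _).trans ((le_max_left _ _).trans hn)
  have hn1 : 1 ≤ n := (le_max_right _ _).trans hn
  have hnr : (1 : ℝ) ≤ n := by exact_mod_cast hn1
  have hn0 : (0 : ℝ) < n := by linarith
  have hd0 : d0 ≤ (n : ℝ) ^ ε := hN2 n hnN2
  obtain ⟨S, hS1, hS2, hS3, hS4⟩ := hcon n hnN1
  have hnε : 0 < (n : ℝ) ^ ε := by positivity
  have hdd : (n : ℝ) ^ ε ≤ C2 * (n : ℝ) ^ ε := le_mul_of_one_le_left hnε.le hC21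
  have hcls : Cls k S (aux k r S) 0 (C2 * (n : ℝ) ^ ε) := by
    apply aux_cls hk hg hS2 hS1
    intro v hv
    refine (hS4 v hv).trans (le_of_eq ?_)
    rw [mul_pow, hC2, one_div, Real.rpow_inv_natCast_pow (by linarith) (by omega),
      ← Real.rpow_natCast, ← Real.rpow_mul hn0.le, mul_comm ε]
  obtain ⟨I, hI1, hI2, hI3⟩ := hhyp (C2 * (n : ℝ) ^ ε) (hd0.trans hdd) (Finset (Fin n)) S _ hcls
  refine ⟨S, I, hS1, hS2, hI1, hI2, le_trans ?_ hI3⟩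
  have hlogn : 0 ≤ Real.log n := Real.log_nonneg hnr
  have hlog : ε * Real.log n ≤ Real.log (C2 * (n : ℝ) ^ ε) := by
    rw [← Real.log_rpow hn0]
    exact Real.log_le_log hnε hdd
  have h1 : ε ^ ((1 : ℝ) / k) * Real.log n ^ ((1 : ℝ) / k) ≤
      Real.log (C2 * (n : ℝ) ^ ε) ^ ((1 : ℝ) / k) := by
    rw [← Real.mul_rpow hε.le hlogn]
    exact Real.rpow_le_rpow (by positivity) hlog (by positivity)
  calc c0 * ε ^ ((1 : ℝ) / k) * κ / C2 * (n : ℝ) ^ ((r : ℝ) / k) * Real.log n ^ ((1 : ℝ) / k)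
      = c0 * (ε ^ ((1 : ℝ) / k) * Real.log n ^ ((1 : ℝ) / k)) / (C2 * (n : ℝ) ^ ε) *
        (κ * (n : ℝ) ^ ((r : ℝ) / k + ε)) := by
        rw [Real.rpow_add hn0]; field_simp
    _ ≤ _ := by
        have h0 : 0 ≤ Real.log (C2 * (n : ℝ) ^ ε) ^ ((1 : ℝ) / k) :=
          le_trans (by positivity) h1
        have h2 : 0 ≤ c0 * Real.log (C2 * (n : ℝ) ^ ε) ^ ((1 : ℝ) / k) / (C2 * (n : ℝ) ^ ε) :=
          div_nonneg (mul_nonneg hc0.le h0) (by positivity)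
        gcongr

end IPPS

/-- Proposition 4.1: for fixed `t ≥ 2`, `r ≥ 3` with `gcd(⌊t²/4⌋ + t, r) = 1`, there is a
`t`-IPPS(r, m, n) with `m = Ω(n^(r/(⌊t²/4⌋+t)) (log n)^(1/(⌊t²/4⌋+t)))`. -/
theorem stmt_14 (t r : ℕ) (ht : 2 ≤ t) (hr : 3 ≤ r)
    (hgcd : Nat.gcd (t ^ 2 / 4 + t) r = 1) :
    ∃ c : ℝ, 0 < c ∧ ∃ N : ℕ, ∀ n : ℕ, N ≤ n →
      ∃ H : Finset (Finset (Fin n)),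
        (∀ A ∈ H, A.card = r) ∧
        (∀ X : Finset (Fin n), X.card = r →
          (∃ P ⊆ H, P.card ≤ t ∧ X ⊆ P.sup id) →
          ∃ A ∈ H, ∀ P ⊆ H, P.card ≤ t → X ⊆ P.sup id → A ∈ P) ∧
        c * (n : ℝ) ^ ((r : ℝ) / ((t ^ 2 / 4 + t : ℕ) : ℝ)) *
          Real.log n ^ ((1 : ℝ) / ((t ^ 2 / 4 + t : ℕ) : ℝ)) ≤ H.card := by
  have hk : 3 ≤ t ^ 2 / 4 + t := by
    have h1 : 4 ≤ t ^ 2 := by nlinarith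
    have h2 : 1 ≤ t ^ 2 / 4 := by omega
    omega
  obtain ⟨c, hc, N, h⟩ := IPPS.main_lemma hk hr hgcd
  refine ⟨c, hc, N, ?_⟩
  intro n hn
  obtain ⟨S, I, h1, h2, h3, h4, h5⟩ := h n hn
  exact ⟨I, fun A hA => h1 A (h3 hA),
    fun X hX hex => IPPS.ipps_of_ind (by omega) h2 h1 h3 h4 X hX hex, h5⟩
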